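/- arXiv:2407.01778 — 2 statements merged into one kernel-verified Lean document; each statement's English description precedes it below -/
import Mathlib

section
/- There exists a constant C > 0 such that for all real numbers x ≥ 2 and y with 16 ≤ y ≤ x^{1/3}, we have | Σ_{x < n ≤ x+y} μ²(n) − y/ζ(2) | ≤ C·x^{2/9}·log x, where the sum is over integers n with x < n ≤ x + y. -/
open scoped Classical

theorem padicValInt_neg' (p : ℕ) (a : ℤ) : padicValInt p (-a) = padicValInt p a := by
  simp [padicValInt]

/-- The `p`-adic valuations of the differences of three points are ultrametric. -/
theorem min_padicValInt_sub_le {p : ℕ} [Fact p.Prime] {u v w : ℤ} (hvw : v ≠ w) :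
    min (padicValInt p (u - v)) (padicValInt p (u - w)) ≤ padicValInt p (v - w) := by
  have h1 : (p : ℤ) ^ min (padicValInt p (u - v)) (padicValInt p (u - w)) ∣ u - v :=
    (pow_dvd_pow _ (min_le_left _ _)).trans (padicValInt_dvd _)
  have h2 : (p : ℤ) ^ min (padicValInt p (u - v)) (padicValInt p (u - w)) ∣ u - w :=
    (pow_dvd_pow _ (min_le_right _ _)).trans (padicValInt_dvd _)
  have h3 : (p : ℤ) ^ min (padicValInt p (u - v)) (padicValInt p (u - w)) ∣ v - w := by
    have := dvd_sub h2 h1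
    rwa [show u - w - (u - v) = v - w by ring] at this
  exact ((padicValInt_dvd_iff _ _).1 h3).resolve_left (sub_ne_zero.2 hvw)

theorem add_min_padicValInt_le {p e : ℕ} [Fact p.Prime] {A q u v w a b c : ℤ}
    (hA : ¬ (p : ℤ) ∣ A) (hq : (p : ℤ) ^ e ∣ q) (huv : u ≠ v) (huw : u ≠ w) (hvw : v ≠ w)
    (h : q * ((a - c) * (u - v) - (a - b) * (u - w)) = A * ((v - w) * (u - w) * (v - u))) :
    e + min (padicValInt p (u - v)) (padicValInt p (u - w)) ≤
      padicValInt p (u - v) + padicValInt p (u - w) + padicValInt p (v - w) := by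
  set g := min (padicValInt p (u - v)) (padicValInt p (u - w)) with hg
  have h1 : (p : ℤ) ^ g ∣ u - v := (pow_dvd_pow _ (min_le_left _ _)).trans (padicValInt_dvd _)
  have h2 : (p : ℤ) ^ g ∣ u - w := (pow_dvd_pow _ (min_le_right _ _)).trans (padicValInt_dvd _)
  have h3 : (p : ℤ) ^ (e + g) ∣ A * ((v - w) * (u - w) * (v - u)) := by
    rw [← h, pow_add]
    exact mul_dvd_mul hq (dvd_sub (h1.mul_left _) (h2.mul_left _))
  have hp : Prime (p : ℤ) := Nat.prime_iff_prime_int.1 Fact.out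
  have h4 : (p : ℤ) ^ (e + g) ∣ (v - w) * (u - w) * (v - u) :=
    (hp.coprime_iff_not_dvd.2 hA).pow_left.dvd_of_dvd_mul_left h3
  have e1 := sub_ne_zero.2 hvw
  have e2 := sub_ne_zero.2 huw
  have e3 := sub_ne_zero.2 huv.symm
  have h5 := ((padicValInt_dvd_iff _ _).1 h4).resolve_left (by positivity)
  rw [padicValInt.mul (by positivity) e3, padicValInt.mul e1 e2, ← neg_sub u v,
    padicValInt_neg'] at h5
  omega

/-- Valuations `x`, `y`, `z` of the three differences of a triple of points at which a quadratic
polynomial, whose leading coefficient has a denominator of valuation `e`, is an integer. -/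
def IsValTriple (e x y z : ℕ) : Prop :=
  (min x y ≤ z ∧ min x z ≤ y ∧ min y z ≤ x) ∧
    (e ≤ x + max y z ∧ e ≤ y + max x z ∧ e ≤ z + max x y)

theorem isValTriple_padicValInt {p e : ℕ} [Fact p.Prime] {α β γ : ℚ} {u v w a b c : ℤ}
    (he : p ^ e ∣ α.den) (he0 : e ≠ 0) (huv : u ≠ v) (huw : u ≠ w) (hvw : v ≠ w)
    (ha : (a : ℚ) = α * u ^ 2 + β * u + γ) (hb : (b : ℚ) = α * v ^ 2 + β * v + γ)
    (hc : (c : ℚ) = α * w ^ 2 + β * w + γ) :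
    IsValTriple e (padicValInt p (u - v)) (padicValInt p (u - w)) (padicValInt p (v - w)) := by
  have hpd : p ∣ α.den := (dvd_pow_self p he0).trans he
  have hA : ¬ (p : ℤ) ∣ α.num := by
    intro h
    have h' : p ∣ α.num.natAbs := Int.natCast_dvd.1 h
    have := Nat.dvd_gcd h' hpd
    rw [α.reduced] at this
    exact (Fact.out : p.Prime).one_lt.ne' (Nat.dvd_one.1 this)
  have hq : (p : ℤ) ^ e ∣ (α.den : ℤ) := by exact_mod_cast he
  have key : ∀ {u v w a b c : ℤ}, (a : ℚ) = α * u ^ 2 + β * u + γ →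
      (b : ℚ) = α * v ^ 2 + β * v + γ → (c : ℚ) = α * w ^ 2 + β * w + γ →
      (α.den : ℤ) * ((a - c) * (u - v) - (a - b) * (u - w)) =
        α.num * ((v - w) * (u - w) * (v - u)) := by
    intro u v w a b c ha hb hc
    have h : (((α.den : ℤ) * ((a - c) * (u - v) - (a - b) * (u - w)) : ℤ) : ℚ) =
        ((α.num * ((v - w) * (u - w) * (v - u)) : ℤ) : ℚ) := by
      push_cast
      rw [ha, hb, hc, ← Rat.mul_den_eq_num α]
      ring
    exact_mod_cast h
  have s : ∀ s t : ℤ, padicValInt p (s - t) = padicValInt p (t - s) := fun s t => by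
    rw [← neg_sub, padicValInt_neg']
  have h1 := add_min_padicValInt_le hA hq huv huw hvw (key ha hb hc)
  have h2 := add_min_padicValInt_le hA hq huv.symm hvw huw (key hb ha hc)
  have h3 := add_min_padicValInt_le hA hq huw.symm hvw.symm huv (key hc ha hb)
  have h4 := min_padicValInt_sub_le (p := p) (u := u) hvw
  have h5 := min_padicValInt_sub_le (p := p) (u := v) huw
  have h6 := min_padicValInt_sub_le (p := p) (u := w) huv
  rw [s v u] at h2 h5
  rw [s w u, s w v] at h3 h6
  unfold IsValTriple
  omega

/-- Five points `i, j, k, l, m`, where the pair `i, j` has the least valuation. -/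
theorem four_mul_le_sum_of_min {e ij ik il jk jl kl im jm km lm : ℕ}
    (h1 : IsValTriple e ij ik jk) (h2 : IsValTriple e ij il jl) (h3 : IsValTriple e ij im jm)
    (h4 : IsValTriple e ik il kl) (h5 : IsValTriple e ik im km) (h6 : IsValTriple e il im lm)
    (h7 : IsValTriple e jk jl kl) (h8 : IsValTriple e jk jm km) (h9 : IsValTriple e jl jm lm)
    (m1 : ij ≤ ik) (m2 : ij ≤ il) (m3 : ij ≤ im) (m4 : ij ≤ jk) (m5 : ij ≤ jl)
    (m6 : ij ≤ jm) (m7 : ij ≤ kl) (m8 : ij ≤ km) (m9 : ij ≤ lm) :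
    4 * e ≤ ij + ik + il + jk + jl + kl + im + jm + km + lm := by
  by_cases hm : e ≤ 2 * ij
  · omega
  have c1 : e ≤ ij + ik ∨ e ≤ ij + jk := by unfold IsValTriple at h1; omega
  have c2 : e ≤ ij + il ∨ e ≤ ij + jl := by unfold IsValTriple at h2; omega
  have c3 : e ≤ ij + im ∨ e ≤ ij + jm := by unfold IsValTriple at h3; omega
  have t4 : min ik il ≤ kl := h4.1.1
  have t5 : min ik im ≤ km := h5.1.1
  have t6 : min il im ≤ lm := h6.1.1
  have t7 : min jk jl ≤ kl := h7.1.1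
  have t8 : min jk jm ≤ km := h8.1.1
  have t9 : min jl jm ≤ lm := h9.1.1
  clear h1 h2 h3 h4 h5 h6 h7 h8 h9
  rcases c1 with c1 | c1 <;> rcases c2 with c2 | c2 <;> rcases c3 with c3 | c3 <;> omega

theorem four_mul_le_sum {e : ℕ} (x : Fin 5 → Fin 5 → ℕ) (hs : ∀ i j, x i j = x j i)
    (hx : ∀ i j k, i ≠ j → i ≠ k → j ≠ k → IsValTriple e (x i j) (x i k) (x j k)) :
    4 * e ≤ x 0 1 + x 0 2 + x 0 3 + x 0 4 + x 1 2 + x 1 3 + x 1 4 + x 2 3 + x 2 4 + x 3 4 := by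
  have key : ∀ i j k l m : Fin 5, [i, j, k, l, m].Nodup → (∀ s t, s ≠ t → x i j ≤ x s t) →
      4 * e ≤ x i j + x i k + x i l + x j k + x j l + x k l + x i m + x j m + x k m + x l m := by
    intro i j k l m hd h
    obtain ⟨⟨ij, ik, il, im⟩, ⟨jk, jl, jm⟩, ⟨kl, km⟩, lm⟩ := by simpa using hd
    exact four_mul_le_sum_of_min (hx i j k ij ik jk) (hx i j l ij il jl) (hx i j m ij im jm)
      (hx i k l ik il kl) (hx i k m ik im km) (hx i l m il im lm) (hx j k l jk jl kl)
      (hx j k m jk jm km) (hx j l m jl jm lm) (h _ _ ik) (h _ _ il) (h _ _ im) (h _ _ jk)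
      (h _ _ jl) (h _ _ jm) (h _ _ kl) (h _ _ km) (h _ _ lm)
  obtain ⟨⟨i, j⟩, hij, hmin⟩ := Finset.exists_min_image
    (Finset.univ.filter fun q : Fin 5 × Fin 5 => q.1 < q.2) (fun q => x q.1 q.2)
    ⟨(0, 1), by simp⟩
  have hmin' : ∀ s t, s ≠ t → x i j ≤ x s t := by
    intro s t hst
    rcases lt_or_gt_of_ne hst with h | h
    · exact hmin (s, t) (by simpa using h)
    · rw [hs s t]; exact hmin (t, s) (by simpa using h)
  clear hmin
  have hij : i < j := by simpa using hij
  have e10 := hs 1 0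
  have e20 := hs 2 0
  have e30 := hs 3 0
  have e40 := hs 4 0
  have e21 := hs 2 1
  have e31 := hs 3 1
  have e41 := hs 4 1
  have e32 := hs 3 2
  have e42 := hs 4 2
  have e43 := hs 4 3
  fin_cases i <;> fin_cases j <;> first | exact absurd hij (by decide) | skip
  · have := key 0 1 2 3 4 (by decide) hmin'
    omega
  · have := key 0 2 1 3 4 (by decide) hmin'
    omega
  · have := key 0 3 1 2 4 (by decide) hmin'
    omega
  · have := key 0 4 1 2 3 (by decide) hmin'
    omega
  · have := key 1 2 0 3 4 (by decide) hmin'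
    omega
  · have := key 1 3 0 2 4 (by decide) hmin'
    omega
  · have := key 1 4 0 2 3 (by decide) hmin'
    omega
  · have := key 2 3 0 1 4 (by decide) hmin'
    omega
  · have := key 2 4 0 1 3 (by decide) hmin'
    omega
  · have := key 3 4 0 1 2 (by decide) hmin'
    omega

/-- If a quadratic polynomial takes integer values at five integers, the fourth power of the
denominator of its leading coefficient divides the product of the differences of these integers. -/
theorem den_pow_four_dvd {α β γ : ℚ} (u m : Fin 5 → ℤ) (hu : Function.Injective u)
    (hm : ∀ i, (m i : ℚ) = α * u i ^ 2 + β * u i + γ) :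
    (α.den : ℤ) ^ 4 ∣ (u 0 - u 1) * (u 0 - u 2) * (u 0 - u 3) * (u 0 - u 4) * (u 1 - u 2) *
      (u 1 - u 3) * (u 1 - u 4) * (u 2 - u 3) * (u 2 - u 4) * (u 3 - u 4) := by
  have hd : ∀ i j, i ≠ j → u i - u j ≠ 0 := fun i j h => sub_ne_zero.2 (hu.ne h)
  have h01 := hd 0 1 (by decide)
  have h02 := hd 0 2 (by decide)
  have h03 := hd 0 3 (by decide)
  have h04 := hd 0 4 (by decide)
  have h12 := hd 1 2 (by decide)
  have h13 := hd 1 3 (by decide)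
  have h14 := hd 1 4 (by decide)
  have h23 := hd 2 3 (by decide)
  have h24 := hd 2 4 (by decide)
  have h34 := hd 3 4 (by decide)
  rw [← Int.natCast_pow, Int.natCast_dvd]
  refine (Nat.factorization_prime_le_iff_dvd (by simp) (Int.natAbs_ne_zero.2 (by positivity))).1 ?_
  intro p hp
  have : Fact p.Prime := ⟨hp⟩
  rw [Nat.factorization_pow, Nat.factorization_def _ hp]
  change _ ≤ padicValInt p _
  simp only [Finsupp.smul_apply, smul_eq_mul]
  by_cases he0 : α.den.factorization p = 0
  · simp [he0]
  rw [padicValInt.mul (by positivity) h34, padicValInt.mul (by positivity) h24,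
    padicValInt.mul (by positivity) h23, padicValInt.mul (by positivity) h14,
    padicValInt.mul (by positivity) h13, padicValInt.mul (by positivity) h12,
    padicValInt.mul (by positivity) h04, padicValInt.mul (by positivity) h03,
    padicValInt.mul h01 h02]
  refine four_mul_le_sum (fun i j => padicValInt p (u i - u j)) (fun i j => ?_) ?_
  · rw [← neg_sub, padicValInt_neg']
  · intro i j k hij hik hjk
    exact isValTriple_padicValInt (Nat.ordProj_dvd _ _) he0 (hu.ne hij) (hu.ne hik) (hu.ne hjk)
      (hm i) (hm j) (hm k)

/-- A quadratic polynomial with integer values at five points of an interval of length `s` has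
leading coefficient with denominator at most `s ^ (5 / 2)`. -/
theorem den_sq_le {α β γ : ℚ} {s : ℕ} (u m : Fin 5 → ℤ) (hu : Function.Injective u)
    (hs : ∀ i j, |u i - u j| ≤ s) (hm : ∀ i, (m i : ℚ) = α * u i ^ 2 + β * u i + γ) :
    α.den ^ 2 ≤ s ^ 5 := by
  have hd : ∀ i j, i ≠ j → u i - u j ≠ 0 := fun i j h => sub_ne_zero.2 (hu.ne h)
  have h1 := Int.le_of_dvd (abs_pos.2 ?_) ((dvd_abs _ _).2 (den_pow_four_dvd u m hu hm))
  · simp only [abs_mul] at h1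
    have h2 : (α.den : ℤ) ^ 4 ≤ s * s * s * s * s * s * s * s * s * s := by
      refine h1.trans ?_
      gcongr <;> apply hs
    have h3 : (α.den ^ 2) ^ 2 ≤ (s ^ 5) ^ 2 := by
      zify
      nlinarith [h2]
    exact (Nat.pow_le_pow_iff_left two_ne_zero).1 h3
  · have h01 := hd 0 1 (by decide)
    have h02 := hd 0 2 (by decide)
    have h03 := hd 0 3 (by decide)
    have h04 := hd 0 4 (by decide)
    have h12 := hd 1 2 (by decide)
    have h13 := hd 1 3 (by decide)
    have h14 := hd 1 4 (by decide)
    have h23 := hd 2 3 (by decide)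
    have h24 := hd 2 4 (by decide)
    have h34 := hd 3 4 (by decide)
    positivity

theorem exists_close_and_spread {B : Finset ℕ} {h : ℕ} (hB : 9 ≤ B.card)
    (hh : ∀ u ∈ B, ∀ v ∈ B, v ≤ u + h) :
    ∃ s : ℕ, 1 ≤ s ∧ B.card * s ≤ 8 * h ∧
      (∃ u : Fin 5 → ℕ, StrictMono u ∧ (∀ i, u i ∈ B) ∧ u 4 ≤ u 0 + s) ∧
      ∃ v ∈ B, ∃ v' ∈ B, ∃ v'' ∈ B, v + s ≤ v' ∧ v' + s ≤ v'' := by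
  obtain ⟨g, hg, hlt⟩ : ∃ g : ℕ → ℕ, (∀ i < B.card, g i ∈ B) ∧
      ∀ i j, i < j → j < B.card → g i < g j := by
    refine ⟨fun i => if hi : i < B.card then B.orderEmbOfFin rfl ⟨i, hi⟩ else 0, ?_, ?_⟩
    · intro i hi
      simp [hi]
    · intro i j hij hj
      simpa [hj, hij.trans hj] using hij
  obtain ⟨i₀, hi₀, hmin⟩ := Finset.exists_min_image (Finset.range (B.card - 4))
    (fun i => g (i + 4) - g i) ⟨0, by simp; omega⟩
  rw [Finset.mem_range] at hi₀
  set s := g (i₀ + 4) - g i₀ with hs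
  have hstep : ∀ i, i + 4 < B.card → g i + s ≤ g (i + 4) := by
    intro i hi
    have h1 := hmin i (by simp; omega)
    have h2 := hlt i (i + 4) (by omega) hi
    omega
  have hmul : ∀ n, 4 * n < B.card → g 0 + n * s ≤ g (4 * n) := by
    intro n
    induction n with
    | zero => simp
    | succ n ih =>
      intro hn
      have h1 := ih (by omega)
      have h2 := hstep (4 * n) (by omega)
      rw [show 4 * (n + 1) = 4 * n + 4 by ring]
      linarith
  refine ⟨s, ?_, ?_, ⟨fun i => g (i₀ + i), ?_, ?_, ?_⟩, g 0, hg _ (by omega), g 4,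
    hg _ (by omega), g 8, hg _ (by omega), hstep 0 (by omega), hstep 4 (by omega)⟩
  · have := hlt i₀ (i₀ + 4) (by omega) (by omega)
    omega
  · have h1 := hmul ((B.card - 1) / 4) (by omega)
    have h2 := hh (g 0) (hg _ (by omega)) (g (4 * ((B.card - 1) / 4))) (hg _ (by omega))
    have h3 : B.card ≤ 8 * ((B.card - 1) / 4) := by omega
    calc B.card * s ≤ 8 * ((B.card - 1) / 4) * s := Nat.mul_le_mul_right _ h3
      _ ≤ 8 * h := by rw [mul_assoc]; omega
  · intro i j hij
    exact hlt _ _ (by simpa using hij) (by omega)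
  · intro i
    exact hg _ (by omega)
  · simp
    omega

theorem card_le_of_sub_le {s : Finset ℕ} {W : ℝ} (hW : 0 ≤ W)
    (h : ∀ a ∈ s, ∀ b ∈ s, a < b → (b : ℝ) - a ≤ W) : (s.card : ℝ) ≤ W + 1 := by
  rcases s.eq_empty_or_nonempty with rfl | hs
  · simp; linarith
  have hsub : s ⊆ Finset.Icc (s.min' hs) (s.max' hs) := fun a ha =>
    Finset.mem_Icc.2 ⟨s.min'_le a ha, s.le_max' a ha⟩
  have h1 := Finset.card_le_card hsub
  rw [Nat.card_Icc] at h1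
  have h2 : s.min' hs ≤ s.max' hs := s.min'_le_max' hs
  have h3 : ((s.max' hs : ℕ) : ℝ) - (s.min' hs : ℕ) ≤ W := by
    rcases h2.eq_or_lt with h4 | h4
    · rw [h4]; simpa using hW
    · exact h _ (s.min'_mem hs) _ (s.max'_mem hs) h4
  have h4 : (s.card : ℝ) ≤ ((s.max' hs + 1 - s.min' hs : ℕ) : ℝ) := by exact_mod_cast h1
  rw [Nat.cast_sub (by omega)] at h4
  push_cast at h4
  linarith

theorem card_rat_le {s : Finset ℚ} {X : ℝ} {N : ℕ} (hX : 0 ≤ X)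
    (h : ∀ α ∈ s, 0 < α ∧ (α : ℝ) ≤ X ∧ α.den ^ 2 ≤ N) : (s.card : ℝ) ≤ X * N := by
  set Q := Nat.sqrt N
  have hden : ∀ α ∈ s, α.den ≤ Q := fun α hα => by
    rw [Nat.le_sqrt']; exact (h α hα).2.2
  have hmap : s.card ≤ (Finset.Icc 1 ⌊X * Q⌋₊ ×ˢ Finset.Icc 1 Q).card := by
    refine Finset.card_le_card_of_injOn (fun α => (α.num.toNat, α.den)) ?_ ?_
    · intro α hα
      have h0 := Rat.num_pos.2 (h α hα).1
      simp only [Finset.coe_product, Set.mem_prod, Finset.mem_coe, Finset.mem_Icc]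
      refine ⟨⟨by omega, Nat.le_floor ?_⟩, α.den_pos, hden α hα⟩
      have h1 : (α : ℝ) * α.den = α.num := by exact_mod_cast Rat.mul_den_eq_num α
      have h2 : ((α.num.toNat : ℕ) : ℝ) = α.num := by
        exact_mod_cast congrArg (Int.cast (R := ℝ)) (Int.toNat_of_nonneg h0.le)
      rw [h2, ← h1]
      have := hden α hα
      exact mul_le_mul (h α hα).2.1 (by exact_mod_cast this) (by positivity) hX
    · intro α hα β hβ hab
      simp only [Prod.mk.injEq] at hab
      have h0 := Rat.num_pos.2 (h α hα).1
      have h1 := Rat.num_pos.2 (h β hβ).1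
      exact Rat.ext (by omega) hab.2
  rw [Finset.card_product, Nat.card_Icc, Nat.card_Icc] at hmap
  have h1 : (s.card : ℝ) ≤ (⌊X * Q⌋₊ : ℝ) * Q := by
    have : s.card ≤ ⌊X * Q⌋₊ * Q := by simpa using hmap
    exact_mod_cast this
  have h2 : (⌊X * Q⌋₊ : ℝ) ≤ X * Q := Nat.floor_le (by positivity)
  have h3 : (Q : ℝ) * Q ≤ N := by exact_mod_cast Nat.sqrt_le N
  nlinarith [mul_le_mul_of_nonneg_right h2 (Nat.cast_nonneg (α := ℝ) Q),
    mul_le_mul_of_nonneg_left h3 hX]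

theorem three_point_identity {x u v w : ℝ} (hu : u ≠ 0) (hv : v ≠ 0) (hw : w ≠ 0) :
    (w - v) * (x / u ^ 2) - (w - u) * (x / v ^ 2) + (v - u) * (x / w ^ 2) =
      (v - u) * (w - v) * (w - u) * (x * (1 / u + 1 / v + 1 / w) / (u * v * w)) := by
  field_simp
  ring

theorem four_point_identity {x u v w z : ℝ} (hu : u ≠ 0) (hv : v ≠ 0) (hw : w ≠ 0) (hz : z ≠ 0) :
    (w - v) * (z - w) * (z - v) * (x / u ^ 2) - (w - u) * (z - w) * (z - u) * (x / v ^ 2) +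
        (v - u) * (z - v) * (z - u) * (x / w ^ 2) - (v - u) * (w - v) * (w - u) * (x / z ^ 2) =
      (v - u) * (w - v) * (w - u) * (z - u) * (z - v) * (z - w) *
        (x * (1 / u + 1 / v + 1 / w + 1 / z) / (u * v * w * z)) := by
  field_simp
  ring

theorem sum_inv_div_le {T u v w : ℝ} (hT : 0 < T) (hu : T ≤ u) (hv : T ≤ v) (hw : T ≤ w) :
    (1 / u + 1 / v + 1 / w) / (u * v * w) ≤ 3 / T ^ 4 := by
  have hu0 := hT.trans_le hu
  have hv0 := hT.trans_le hv
  have hw0 := hT.trans_le hw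
  calc (1 / u + 1 / v + 1 / w) / (u * v * w)
      ≤ (1 / T + 1 / T + 1 / T) / (T * T * T) := by gcongr
    _ = 3 / T ^ 4 := by field_simp; ring

theorem le_sum_inv_div {T u v w : ℝ} (hu0 : 0 < u) (hv0 : 0 < v) (hw0 : 0 < w)
    (hu : u ≤ T) (hv : v ≤ T) (hw : w ≤ T) :
    3 / T ^ 4 ≤ (1 / u + 1 / v + 1 / w) / (u * v * w) := by
  have hT := hu0.trans_le hu
  calc 3 / T ^ 4 = (1 / T + 1 / T + 1 / T) / (T * T * T) := by field_simp; ring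
    _ ≤ (1 / u + 1 / v + 1 / w) / (u * v * w) := by gcongr

theorem sum_inv_div_le_four {T u v w z : ℝ} (hT : 0 < T) (hu : T ≤ u) (hv : T ≤ v) (hw : T ≤ w)
    (hz : T ≤ z) :
    (1 / u + 1 / v + 1 / w + 1 / z) / (u * v * w * z) ≤ 4 / T ^ 5 := by
  have hu0 := hT.trans_le hu
  have hv0 := hT.trans_le hv
  have hw0 := hT.trans_le hw
  have hz0 := hT.trans_le hz
  calc (1 / u + 1 / v + 1 / w + 1 / z) / (u * v * w * z)
      ≤ (1 / T + 1 / T + 1 / T + 1 / T) / (T * T * T * T) := by gcongr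
    _ = 4 / T ^ 5 := by field_simp; ring

/-- The second divided difference of integers close to the values of `x / u ^ 2`. -/
theorem abs_second_difference_sub_le {x δ u v w a b c : ℝ} (hu0 : 0 < u) (huv : u < v)
    (hvw : v < w) (ha : 0 ≤ a - x / u ^ 2) (ha' : a - x / u ^ 2 ≤ δ) (hb : 0 ≤ b - x / v ^ 2)
    (hb' : b - x / v ^ 2 ≤ δ) (hc : 0 ≤ c - x / w ^ 2) (hc' : c - x / w ^ 2 ≤ δ) :
    |((w - v) * a - (w - u) * b + (v - u) * c) -
      (v - u) * (w - v) * (w - u) * (x * ((1 / u + 1 / v + 1 / w) / (u * v * w)))| ≤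
        (w - u) * δ := by
  rw [← mul_div_assoc, ← three_point_identity hu0.ne' (hu0.trans huv).ne'
    (hu0.trans (huv.trans hvw)).ne', abs_le]
  have h1 : 0 < v - u := sub_pos.2 huv
  have h2 : 0 < w - v := sub_pos.2 hvw
  constructor <;>
  nlinarith [mul_nonneg h2.le ha, mul_nonneg h1.le hc, mul_nonneg (add_pos h1 h2).le hb,
    mul_le_mul_of_nonneg_left ha' h2.le, mul_le_mul_of_nonneg_left hc' h1.le,
    mul_le_mul_of_nonneg_left hb' (add_pos h1 h2).le]

theorem abs_third_difference_lt_one {x y T h u v w z a b c d : ℝ} (hT : 0 < T) (hx : 0 < x)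
    (hy : 0 < y)
    (hu0 : T < u) (huv : u < v) (hvw : v < w) (hwz : w < z) (hzu : z ≤ u + h)
    (h1 : 16 * x * h ^ 6 ≤ T ^ 5) (h2 : 4 * y * h ^ 3 ≤ T ^ 2)
    (ha : 0 ≤ a - x / u ^ 2) (ha' : a - x / u ^ 2 ≤ y / T ^ 2) (hb : 0 ≤ b - x / v ^ 2)
    (hb' : b - x / v ^ 2 ≤ y / T ^ 2) (hc : 0 ≤ c - x / w ^ 2) (hc' : c - x / w ^ 2 ≤ y / T ^ 2)
    (hd : 0 ≤ d - x / z ^ 2) (hd' : d - x / z ^ 2 ≤ y / T ^ 2) :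
    |(w - v) * (z - w) * (z - v) * a - (w - u) * (z - w) * (z - u) * b +
        (v - u) * (z - v) * (z - u) * c - (v - u) * (w - v) * (w - u) * d| < 1 := by
  have hv0 := hu0.trans huv
  have hw0 := hv0.trans hvw
  have hz0 := hw0.trans hwz
  have id4 := four_point_identity (x := x) (hT.trans hu0).ne' (hT.trans hv0).ne'
    (hT.trans hw0).ne' (hT.trans hz0).ne'
  have hG := sum_inv_div_le_four hT hu0.le hv0.le hw0.le hz0.le
  have hG0 : 0 ≤ (1 / u + 1 / v + 1 / w + 1 / z) / (u * v * w * z) := by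
    have := hT.trans hu0
    have := hT.trans hv0
    have := hT.trans hw0
    have := hT.trans hz0
    positivity
  rw [mul_div_assoc] at id4
  set G := (1 / u + 1 / v + 1 / w + 1 / z) / (u * v * w * z)
  set δ := y / T ^ 2 with hδ
  have hδ0 : 0 < δ := by positivity
  have hh : 0 < h := by linarith
  have d1 : 0 < v - u := sub_pos.2 huv
  have d2 : 0 < w - v := sub_pos.2 hvw
  have d3 : 0 < z - w := sub_pos.2 hwz
  have d4 : 0 < w - u := by linarith
  have d5 : 0 < z - v := by linarith
  have d6 : 0 < z - u := by linarith
  have b1 : v - u ≤ h := by linarith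
  have b2 : w - v ≤ h := by linarith
  have b3 : z - w ≤ h := by linarith
  have b4 : w - u ≤ h := by linarith
  have b5 : z - v ≤ h := by linarith
  have b6 : z - u ≤ h := by linarith
  have mul3 : ∀ p q r e : ℝ, 0 < p → p ≤ h → 0 < q → q ≤ h → 0 < r → r ≤ h → 0 ≤ e → e ≤ δ →
      0 ≤ p * q * r * e ∧ p * q * r * e ≤ h * h * h * δ := by
    intro p q r e hp hp' hq hq' hr hr' he he'
    exact ⟨by positivity, by gcongr⟩
  have hN : (v - u) * (w - v) * (w - u) * (z - u) * (z - v) * (z - w) * (x * G) ≤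
      h * h * h * h * h * h * (x * (4 / T ^ 5)) := by gcongr
  have hN0 : 0 ≤ (v - u) * (w - v) * (w - u) * (z - u) * (z - v) * (z - w) * (x * G) := by
    positivity
  have hN1 : h * h * h * h * h * h * (x * (4 / T ^ 5)) ≤ 1 / 4 := by
    rw [show h * h * h * h * h * h * (x * (4 / T ^ 5)) = (16 * x * h ^ 6) / T ^ 5 / 4 by ring]
    have := (div_le_one (by positivity)).2 h1
    linarith
  have hE : h * h * h * δ ≤ 1 / 4 := by
    rw [hδ, show h * h * h * (y / T ^ 2) = (4 * y * h ^ 3) / T ^ 2 / 4 by ring]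
    have := (div_le_one (by positivity)).2 h2
    linarith
  obtain ⟨p1, p1'⟩ := mul3 _ _ _ _ d2 b2 d3 b3 d5 b5 ha ha'
  obtain ⟨p2, p2'⟩ := mul3 _ _ _ _ d4 b4 d3 b3 d6 b6 hb hb'
  obtain ⟨p3, p3'⟩ := mul3 _ _ _ _ d1 b1 d5 b5 d6 b6 hc hc'
  obtain ⟨p4, p4'⟩ := mul3 _ _ _ _ d1 b1 d2 b2 d4 b4 hd hd'
  rw [mul_sub] at p1 p1' p2 p2' p3 p3' p4 p4'
  rw [abs_lt]
  constructor <;> linarith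

/-- Some multiple of `d ^ 2` lies in the interval `(x, x + y]`. -/
def HasSqMultiple (x y : ℝ) (d : ℕ) : Prop :=
  ∃ m : ℕ, x < (d : ℝ) ^ 2 * m ∧ (d : ℝ) ^ 2 * m ≤ x + y

theorem sub_div_sq_bounds {x y T d m : ℝ} (hT : 0 < T) (hd : T < d) (hy : 0 < y)
    (h1 : x < d ^ 2 * m) (h2 : d ^ 2 * m ≤ x + y) :
    0 ≤ m - x / d ^ 2 ∧ m - x / d ^ 2 ≤ y / T ^ 2 := by
  have hd0 := hT.trans hd
  have h3 : m - x / d ^ 2 = (d ^ 2 * m - x) / d ^ 2 := by field_simp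
  rw [h3]
  refine ⟨div_nonneg (by linarith) (by positivity), ?_⟩
  gcongr
  linarith

theorem exists_quadratic {B : Finset ℕ} {m : ℕ → ℤ} {v v' v'' : ℕ} (hv : v ∈ B) (hv' : v' ∈ B)
    (hv'' : v'' ∈ B) (h1 : v < v') (h2 : v' < v'')
    (hD : ∀ u ∈ B, ∀ v ∈ B, ∀ w ∈ B, ∀ z ∈ B, u < v → v < w → w < z →
      ((w : ℤ) - v) * (z - w) * (z - v) * m u - (w - u) * (z - w) * (z - u) * m v +
        (v - u) * (z - v) * (z - u) * m w - (v - u) * (w - v) * (w - u) * m z = 0) :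
    ∃ α β γ : ℚ, ∀ w ∈ B, (m w : ℚ) = α * w ^ 2 + β * w + γ := by
  have hD' : ∀ u ∈ B, ∀ v ∈ B, ∀ w ∈ B, ∀ z ∈ B, u < v → v < w → w < z →
      ((w : ℚ) - v) * (z - w) * (z - v) * m u - (w - u) * (z - w) * (z - u) * m v +
        (v - u) * (z - v) * (z - u) * m w - (v - u) * (w - v) * (w - u) * m z = 0 := by
    intro u hu v hv w hw z hz h1 h2 h3
    exact_mod_cast hD u hu v hv w hw z hz h1 h2 h3
  have q1 : (v : ℚ) < v' := by exact_mod_cast h1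
  have q2 : (v' : ℚ) < v'' := by exact_mod_cast h2
  set V : ℚ := ((v' : ℚ) - v) * (v'' - v') * (v'' - v) with hV
  have hV0 : V ≠ 0 := by
    have := sub_pos.2 q1
    have := sub_pos.2 q2
    have := sub_pos.2 (q1.trans q2)
    positivity
  refine ⟨(m v * (v'' - v') - m v' * (v'' - v) + m v'' * (v' - v)) / V,
    -(m v * (v' + v'') * (v'' - v') - m v' * (v + v'') * (v'' - v) +
      m v'' * (v + v') * (v' - v)) / V,
    (m v * v' * v'' * (v'' - v') - m v' * v * v'' * (v'' - v) + m v'' * v * v' * (v' - v)) / V,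
    fun w hw => ?_⟩
  rw [div_mul_eq_mul_div, div_mul_eq_mul_div, ← add_div, ← add_div, eq_div_iff hV0, hV]
  rcases lt_trichotomy w v with h | rfl | h
  · linear_combination hD' w hw v hv v' hv' v'' hv'' h h1 h2
  · ring
  rcases lt_trichotomy w v' with h' | rfl | h'
  · linear_combination -hD' v hv w hw v' hv' v'' hv'' h h' h2
  · ring
  rcases lt_trichotomy w v'' with h3 | rfl | h3
  · linear_combination hD' v hv v' hv' w hw v'' hv'' h1 h' h3
  · ring
  · linear_combination -hD' v hv v' hv' v'' hv'' w hw h1 h2 h3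

/-- The leading coefficient of a quadratic polynomial through points close to `x / u ^ 2`. -/
theorem abs_leadingCoeff_sub_le {x δ α β γ u v w : ℝ} (hu0 : 0 < u) (huv : u < v)
    (hvw : v < w) (ha : 0 ≤ (α * u ^ 2 + β * u + γ) - x / u ^ 2)
    (ha' : (α * u ^ 2 + β * u + γ) - x / u ^ 2 ≤ δ)
    (hb : 0 ≤ (α * v ^ 2 + β * v + γ) - x / v ^ 2)
    (hb' : (α * v ^ 2 + β * v + γ) - x / v ^ 2 ≤ δ)
    (hc : 0 ≤ (α * w ^ 2 + β * w + γ) - x / w ^ 2)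
    (hc' : (α * w ^ 2 + β * w + γ) - x / w ^ 2 ≤ δ) :
    (v - u) * (w - v) * |α - x * ((1 / u + 1 / v + 1 / w) / (u * v * w))| ≤ δ := by
  have h := abs_second_difference_sub_le hu0 huv hvw ha ha' hb hb' hc hc'
  have h1 : 0 < v - u := sub_pos.2 huv
  have h2 : 0 < w - v := sub_pos.2 hvw
  have h3 : 0 < w - u := by linarith
  set G := (1 / u + 1 / v + 1 / w) / (u * v * w)
  rw [show ((w - v) * (α * u ^ 2 + β * u + γ) - (w - u) * (α * v ^ 2 + β * v + γ) +
    (v - u) * (α * w ^ 2 + β * w + γ)) - (v - u) * (w - v) * (w - u) * (x * G) =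
    (w - u) * ((v - u) * (w - v) * (α - x * G)) by ring, abs_mul, abs_of_pos h3,
    abs_mul, abs_of_pos (mul_pos h1 h2)] at h
  exact le_of_mul_le_mul_left h h3

/-- Data attached to a short block containing at least nine integers whose squares have a multiple
in `(x, x + y]`. -/
theorem exists_rat_of_block {x y T : ℝ} {h : ℕ} {B : Finset ℕ} (hT : 0 < T) (hx : 0 < x)
    (hy : 0 < y) (h1 : 16 * x * (h : ℝ) ^ 6 ≤ T ^ 5) (h2 : 4 * y * (h : ℝ) ^ 3 ≤ T ^ 2)
    (h3 : 16 * y * T ^ 2 ≤ x) (hB : 9 ≤ B.card) (hBT : ∀ d ∈ B, T < d ∧ (d : ℝ) ≤ 2 * T)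
    (hBx : ∀ d ∈ B, HasSqMultiple x y d) (hBh : ∀ u ∈ B, ∀ v ∈ B, v ≤ u + h) :
    ∃ (α : ℚ) (s : ℕ), 1 ≤ s ∧ α.den ^ 2 ≤ s ^ 5 ∧ B.card * s ≤ 8 * h ∧ 0 < α ∧
      (α : ℝ) ≤ 4 * x / T ^ 4 ∧ ∃ u ∈ B, ∃ v ∈ B, ∃ w ∈ B, (s : ℝ) ^ 2 *
        |(α : ℝ) - x * ((1 / (u : ℝ) + 1 / v + 1 / w) / (u * v * w))| ≤ y / T ^ 2 := by
  obtain ⟨s, hs1, hsB, ⟨f, hfm, hfB, hfs⟩, u, hu, v, hv, w, hw, huv, hvw⟩ :=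
    exists_close_and_spread hB hBh
  choose! m hm1 hm2 using hBx
  have hm : ∀ d ∈ B, 0 ≤ (m d : ℝ) - x / (d : ℝ) ^ 2 ∧
      (m d : ℝ) - x / (d : ℝ) ^ 2 ≤ y / T ^ 2 := fun d hd =>
    sub_div_sq_bounds hT (hBT d hd).1 hy (hm1 d hd) (hm2 d hd)
  obtain ⟨α, β, γ, hP⟩ := exists_quadratic (m := fun d => (m d : ℤ)) hu hv hw
    (by omega) (by omega) (by
      intro u hu v hv w hw z hz huv hvw hwz
      have := abs_third_difference_lt_one (h := (h : ℝ)) hT hx hy (hBT u hu).1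
        (Nat.cast_lt.2 huv) (Nat.cast_lt.2 hvw) (Nat.cast_lt.2 hwz)
        (by exact_mod_cast hBh u hu z hz) h1 h2 (hm u hu).1 (hm u hu).2 (hm v hv).1 (hm v hv).2
        (hm w hw).1 (hm w hw).2 (hm z hz).1 (hm z hz).2
      rw [← Int.abs_lt_one_iff]
      exact_mod_cast this)
  have hPr : ∀ d ∈ B, (m d : ℝ) = α * (d : ℝ) ^ 2 + β * d + γ := fun d hd => by
    have := hP d hd
    exact_mod_cast congrArg (Rat.cast (K := ℝ)) this
  have hden : α.den ^ 2 ≤ s ^ 5 := by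
    refine den_sq_le (β := β) (γ := γ) (fun i => (f i : ℤ)) (fun i => (m (f i) : ℤ))
      (fun i j hij => hfm.injective (by simpa using hij)) (fun i j => ?_) (fun i => ?_)
    · have h5 : f 0 ≤ f i := hfm.monotone (Fin.zero_le i)
      have h6 : f 0 ≤ f j := hfm.monotone (Fin.zero_le j)
      have h7 : f i ≤ f 4 := hfm.monotone (Fin.le_last i)
      have h8 : f j ≤ f 4 := hfm.monotone (Fin.le_last j)
      rw [abs_le]
      constructor <;> omega
    · exact_mod_cast hP (f i) (hfB i)
  have ruv : (u : ℝ) + s ≤ v := by exact_mod_cast huv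
  have rvw : (v : ℝ) + s ≤ w := by exact_mod_cast hvw
  have rs : (1 : ℝ) ≤ s := by exact_mod_cast hs1
  have hu0 : (0 : ℝ) < u := hT.trans (hBT u hu).1
  have hmu := hm u hu
  have hmv := hm v hv
  have hmw := hm w hw
  rw [hPr u hu] at hmu
  rw [hPr v hv] at hmv
  rw [hPr w hw] at hmw
  have hlead := abs_leadingCoeff_sub_le hu0 (by linarith) (by linarith) hmu.1 hmu.2 hmv.1 hmv.2
    hmw.1 hmw.2
  have hG1 := sum_inv_div_le hT (hBT u hu).1.le (hBT v hv).1.le (hBT w hw).1.le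
  have hG2 := le_sum_inv_div hu0 (by linarith) (by linarith) (hBT u hu).2 (hBT v hv).2
    (hBT w hw).2
  set G := (1 / (u : ℝ) + 1 / v + 1 / w) / (u * v * w)
  have hs2 : (s : ℝ) ^ 2 * |(α : ℝ) - x * G| ≤ y / T ^ 2 := by
    refine le_trans ?_ hlead
    rw [sq]
    gcongr <;> linarith
  have habs : |(α : ℝ) - x * G| ≤ y / T ^ 2 := by
    refine le_trans ?_ hs2
    exact le_mul_of_one_le_left (abs_nonneg _) (one_le_pow₀ rs)
  have hδ : y / T ^ 2 ≤ x / (16 * T ^ 4) := by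
    rw [div_le_div_iff₀ (by positivity) (by positivity)]
    nlinarith [mul_le_mul_of_nonneg_right h3 (sq_nonneg T)]
  have hxG1 : x * G ≤ x * (3 / T ^ 4) := by gcongr
  have hxG2 : x * (3 / (2 * T) ^ 4) ≤ x * G := by gcongr
  have e1 : x * (3 / (2 * T) ^ 4) = 3 * (x / (16 * T ^ 4)) := by ring
  have e2 : x * (3 / T ^ 4) = 48 * (x / (16 * T ^ 4)) := by ring
  have e3 : 4 * x / T ^ 4 = 64 * (x / (16 * T ^ 4)) := by ring
  have hpos : 0 < x / (16 * T ^ 4) := by positivity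
  rw [abs_le] at habs
  refine ⟨α, s, hs1, hden, hsB, ?_, by linarith [habs.2], u, hu, v, hv, w, hw, hs2⟩
  have : (0 : ℝ) < α := by linarith [habs.1]
  exact_mod_cast this

theorem sub_le_of_leadingCoeff_close {x T ε α X X' u v w u' v' w' : ℝ} (hx : 0 < x)
    (hX : X ≤ X') (hu0 : 0 < u) (hv0 : 0 < v) (hw0 : 0 < w) (hu : u ≤ X) (hv : v ≤ X)
    (hw : w ≤ X) (hu' : X' ≤ u') (hv' : X' ≤ v') (hw' : X' ≤ w') (hT : u' ≤ 2 * T)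
    (h : |α - x * ((1 / u + 1 / v + 1 / w) / (u * v * w))| ≤ ε)
    (h' : |α - x * ((1 / u' + 1 / v' + 1 / w') / (u' * v' * w'))| ≤ ε) :
    3 * x * (X' - X) ≤ 64 * ε * T ^ 5 := by
  have hX0 : 0 < X := hu0.trans_le hu
  have hX0' : 0 < X' := hX0.trans_le hX
  have hε : 0 ≤ ε := (abs_nonneg _).trans h
  have h1 := mul_le_mul_of_nonneg_left (le_sum_inv_div hu0 hv0 hw0 hu hv hw) hx.le
  have h2 := mul_le_mul_of_nonneg_left (sum_inv_div_le hX0' hu' hv' hw') hx.le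
  rw [abs_le] at h h'
  have h3 : x * (3 / X ^ 4) - x * (3 / X' ^ 4) ≤ 2 * ε := by linarith [h.1, h'.2]
  have h4 : x * (3 / X ^ 4) - x * (3 / X' ^ 4) = 3 * x * (X' ^ 4 - X ^ 4) / (X ^ 4 * X' ^ 4) := by
    field_simp
  rw [h4, div_le_iff₀ (by positivity)] at h3
  have h5 : (X' - X) * X' ^ 3 ≤ X' ^ 4 - X ^ 4 := by
    have : X ^ 3 ≤ X' ^ 3 := by gcongr
    nlinarith [mul_le_mul_of_nonneg_left this hX0.le]
  have h6 : X' ^ 3 * (3 * x * (X' - X)) ≤ X' ^ 3 * (2 * ε * (X ^ 4 * X')) := by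
    calc X' ^ 3 * (3 * x * (X' - X)) = 3 * x * ((X' - X) * X' ^ 3) := by ring
      _ ≤ 3 * x * (X' ^ 4 - X ^ 4) := by gcongr
      _ ≤ 2 * ε * (X ^ 4 * X' ^ 4) := h3
      _ = _ := by ring
  have h7 := le_of_mul_le_mul_left h6 (by positivity)
  refine h7.trans ?_
  have h8 : X' ≤ 2 * T := hu'.trans hT
  calc 2 * ε * (X ^ 4 * X') ≤ 2 * ε * ((2 * T) ^ 4 * (2 * T)) := by
        gcongr
        exact hX.trans h8
    _ = 64 * ε * T ^ 5 := by ring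

/-- The number of `d ∈ (T, 2T]` such that `d ^ 2` has a multiple in `(x, x + y]`, in terms of an
admissible block length `h`. -/
theorem card_hasSqMultiple_le {x y T : ℝ} {h : ℕ} {S : Finset ℕ} (hT : 0 < T) (hx : 0 < x)
    (hy : 0 < y) (hh : 1 ≤ h) (h1 : 16 * x * (h : ℝ) ^ 6 ≤ T ^ 5)
    (h2 : 4 * y * (h : ℝ) ^ 3 ≤ T ^ 2) (h3 : 16 * y * T ^ 2 ≤ x)
    (h4 : 64 * y * T ^ 3 ≤ 3 * x * (h : ℝ) ^ 3)
    (hS : ∀ d ∈ S, T < d ∧ (d : ℝ) ≤ 2 * T ∧ HasSqMultiple x y d) :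
    (S.card : ℝ) ≤ 8 * (2 * T / h + 1) + 6144 * x * (h : ℝ) ^ 5 / T ^ 4 := by
  have hh0 : (0 : ℝ) < h := by exact_mod_cast hh
  set B : ℕ → Finset ℕ := fun b => S.filter fun d => d / h = b with hBdef
  set R := Finset.range (⌊2 * T⌋₊ / h + 1) with hR
  have hmaps : ∀ d ∈ S, d / h ∈ R := by
    intro d hd
    rw [hR, Finset.mem_range, Nat.lt_succ_iff]
    exact Nat.div_le_div_right (Nat.le_floor (hS d hd).2.1)
  have hcard : (S.card : ℝ) = ∑ b ∈ R, ((B b).card : ℝ) := by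
    rw [Finset.card_eq_sum_card_fiberwise hmaps]
    push_cast
    rfl
  have hRcard : (R.card : ℝ) ≤ 2 * T / h + 1 := by
    rw [hR, Finset.card_range]
    push_cast
    have : ((⌊2 * T⌋₊ / h : ℕ) : ℝ) ≤ (⌊2 * T⌋₊ : ℝ) / h := Nat.cast_div_le
    have h5 : (⌊2 * T⌋₊ : ℝ) / h ≤ 2 * T / h := by
      gcongr
      exact Nat.floor_le (by positivity)
    linarith
  have hlow : ∀ b, ∀ d ∈ B b, b * h ≤ d := by
    intro b d hd
    rw [← (Finset.mem_filter.1 hd).2]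
    exact Nat.div_mul_le_self d h
  have hupp : ∀ b, ∀ d ∈ B b, d ≤ (b + 1) * h := by
    intro b d hd
    rw [← (Finset.mem_filter.1 hd).2]
    exact ((Nat.div_lt_iff_lt_mul hh).1 (Nat.lt_succ_self _)).le
  set G := R.filter fun b => 9 ≤ (B b).card with hG
  have hdata : ∀ b ∈ G, ∃ (α : ℚ) (s : ℕ), 1 ≤ s ∧ α.den ^ 2 ≤ s ^ 5 ∧ (B b).card * s ≤ 8 * h ∧
      0 < α ∧ (α : ℝ) ≤ 4 * x / T ^ 4 ∧ ∃ u ∈ B b, ∃ v ∈ B b, ∃ w ∈ B b, (s : ℝ) ^ 2 *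
        |(α : ℝ) - x * ((1 / (u : ℝ) + 1 / v + 1 / w) / (u * v * w))| ≤ y / T ^ 2 := by
    intro b hb
    refine exists_rat_of_block hT hx hy h1 h2 h3 (Finset.mem_filter.1 hb).2
      (fun d hd => ?_) (fun d hd => ?_) (fun u hu v hv => ?_)
    · have := hS d (Finset.mem_filter.1 hd).1
      exact ⟨this.1, this.2.1⟩
    · exact (hS d (Finset.mem_filter.1 hd).1).2.2
    · have h5 := hlow b u hu
      have h6 := hupp b v hv
      linarith
  choose! α s hs1 hden hsB hα0 hα huvw using hdata
  have hsh : ∀ b ∈ G, s b ≤ h := by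
    intro b hb
    have h5 := hsB b hb
    have h6 : 9 ≤ (B b).card := (Finset.mem_filter.1 hb).2
    have h7 := Nat.mul_le_mul_right (s b) h6
    omega
  have hclass : ∀ j : ℕ, 2 ^ j ≤ h → (((G.filter fun b => Nat.log 2 (s b) = j).card : ℕ) : ℝ) ≤
      384 * x * (h : ℝ) ^ 2 / T ^ 4 * 8 ^ j := by
    intro j hj
    set Gj := G.filter fun b => Nat.log 2 (s b) = j with hGj
    have hjh : (2 : ℝ) ^ j ≤ h := by exact_mod_cast hj
    have hlo : ∀ b ∈ Gj, 2 ^ j ≤ s b := by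
      intro b hb
      obtain ⟨hb, hb'⟩ := Finset.mem_filter.1 hb
      rw [← hb']
      exact Nat.pow_log_le_self 2 (by have := hs1 b hb; omega)
    have hhi : ∀ b ∈ Gj, s b ≤ 2 ^ (j + 1) := by
      intro b hb
      obtain ⟨hb, hb'⟩ := Finset.mem_filter.1 hb
      rw [← hb']
      exact (Nat.lt_pow_succ_log_self one_lt_two _).le
    have hfib : ∀ a ∈ Gj.image α, (Gj.filter fun b => α b = a).card ≤
        ⌊3 * ((h : ℝ) ^ 2 / 4 ^ j)⌋₊ := by
      intro a _
      refine Nat.le_floor ?_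
      have hone : 1 ≤ (h : ℝ) ^ 2 / 4 ^ j := by
        rw [one_le_div (by positivity), show (4 : ℝ) ^ j = (2 ^ j) ^ 2 by
          rw [← pow_mul, mul_comm, pow_mul]; norm_num]
        gcongr
      have := card_le_of_sub_le (s := Gj.filter fun b => α b = a)
        (W := 1 + (h : ℝ) ^ 2 / 4 ^ j) (by positivity) ?_
      · linarith
      intro b hb b' hb' hbb
      obtain ⟨hb, hab⟩ := Finset.mem_filter.1 hb
      obtain ⟨hb', hab'⟩ := Finset.mem_filter.1 hb'
      have hbG := (Finset.mem_filter.1 hb).1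
      have hbG' := (Finset.mem_filter.1 hb').1
      obtain ⟨u, hu, v, hv, w, hw, hc⟩ := huvw b hbG
      obtain ⟨u', hu', v', hv', w', hw', hc'⟩ := huvw b' hbG'
      rw [hab] at hc
      rw [hab'] at hc'
      have hscale : ∀ c ∈ Gj, ∀ z : ℝ, (s c : ℝ) ^ 2 * |z| ≤ y / T ^ 2 →
          |z| ≤ y / T ^ 2 / 4 ^ j := by
        intro c hc z hz
        rw [le_div_iff₀ (by positivity), mul_comm]
        refine le_trans ?_ hz
        gcongr
        rw [show (4 : ℝ) ^ j = (2 ^ j) ^ 2 by rw [← pow_mul, mul_comm, pow_mul]; norm_num]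
        gcongr
        exact_mod_cast hlo c hc
      have hpos : ∀ b, ∀ d ∈ B b, (0 : ℝ) < d := fun b d hd =>
        hT.trans (hS d (Finset.mem_filter.1 hd).1).1
      have hl : ∀ d ∈ B b', ((b' : ℝ) * h) ≤ d := fun d hd => by exact_mod_cast hlow b' d hd
      have hr : ∀ d ∈ B b, (d : ℝ) ≤ ((b : ℝ) + 1) * h := fun d hd => by
        exact_mod_cast hupp b d hd
      have hbb1 : (b : ℝ) + 1 ≤ b' := by exact_mod_cast hbb
      have key := sub_le_of_leadingCoeff_close (T := T) hx
        (mul_le_mul_of_nonneg_right hbb1 hh0.le) (hpos b u hu)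
        (hpos b v hv) (hpos b w hw) (hr u hu) (hr v hv) (hr w hw) (hl u' hu') (hl v' hv')
        (hl w' hw') (hS u' (Finset.mem_filter.1 hu').1).2.1 (hscale b hb _ hc)
        (hscale b' hb' _ hc')
      have e1 : 64 * (y / T ^ 2 / 4 ^ j) * T ^ 5 = 64 * y * T ^ 3 / 4 ^ j := by
        field_simp
      have e2 : 64 * y * T ^ 3 / 4 ^ j ≤ 3 * x * (h : ℝ) ^ 3 / 4 ^ j := by gcongr
      have e3 : 3 * x * (h : ℝ) ^ 3 / 4 ^ j = (3 * x * h) * ((h : ℝ) ^ 2 / 4 ^ j) := by ring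
      have e4 : (3 * x * h) * ((b' : ℝ) - b - 1) ≤ (3 * x * h) * ((h : ℝ) ^ 2 / 4 ^ j) := by
        rw [← e3]
        refine le_trans (le_of_eq ?_) (key.trans (e1.le.trans e2))
        ring
      have := le_of_mul_le_mul_left e4 (by positivity)
      linarith
    have himg : (((Gj.image α).card : ℕ) : ℝ) ≤ 4 * x / T ^ 4 * (((2 ^ (j + 1)) ^ 5 : ℕ) : ℝ) := by
      refine card_rat_le (by positivity) ?_
      intro a ha
      obtain ⟨b, hb, rfl⟩ := Finset.mem_image.1 ha
      have hbG := (Finset.mem_filter.1 hb).1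
      exact ⟨hα0 b hbG, hα b hbG, (hden b hbG).trans (Nat.pow_le_pow_left (hhi b hb) 5)⟩
    have hle := Finset.card_le_mul_card_image Gj _ hfib
    calc (Gj.card : ℝ) ≤ (⌊3 * ((h : ℝ) ^ 2 / 4 ^ j)⌋₊ : ℝ) * ((Gj.image α).card : ℝ) := by
          exact_mod_cast hle
      _ ≤ (3 * ((h : ℝ) ^ 2 / 4 ^ j)) * (4 * x / T ^ 4 * (((2 ^ (j + 1)) ^ 5 : ℕ) : ℝ)) := by
          gcongr
          exact Nat.floor_le (by positivity)
      _ = 384 * x * (h : ℝ) ^ 2 / T ^ 4 * 8 ^ j := by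
          push_cast
          have : ((2 : ℝ) ^ (j + 1)) ^ 5 = 32 * (4 ^ j * 8 ^ j) := by
            rw [← mul_pow, ← pow_mul, mul_comm (j + 1), pow_mul, pow_succ]
            norm_num
            ring
          rw [this]
          field_simp
          norm_num
  have hgood : ∑ b ∈ G, ((B b).card : ℝ) ≤ 6144 * x * (h : ℝ) ^ 5 / T ^ 4 := by
    have hmapsG : ∀ b ∈ G, Nat.log 2 (s b) ∈ Finset.range (Nat.log 2 h + 1) := by
      intro b hb
      rw [Finset.mem_range, Nat.lt_succ_iff]
      exact Nat.log_mono_right (hsh b hb)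
    rw [← Finset.sum_fiberwise_of_maps_to hmapsG]
    calc ∑ j ∈ Finset.range (Nat.log 2 h + 1), ∑ b ∈ G with Nat.log 2 (s b) = j, ((B b).card : ℝ)
        ≤ ∑ j ∈ Finset.range (Nat.log 2 h + 1), 3072 * x * (h : ℝ) ^ 3 / T ^ 4 * 4 ^ j := by
          refine Finset.sum_le_sum fun j hj => ?_
          have hj' : 2 ^ j ≤ h := Nat.pow_le_of_le_log (by omega)
            (Nat.lt_succ_iff.1 (Finset.mem_range.1 hj))
          have hb : ∀ b ∈ G.filter (fun b => Nat.log 2 (s b) = j),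
              ((B b).card : ℝ) ≤ 8 * h / 2 ^ j := by
            intro b hb
            obtain ⟨hb, hb'⟩ := Finset.mem_filter.1 hb
            rw [le_div_iff₀ (by positivity)]
            have h5 : 2 ^ j ≤ s b := by
              rw [← hb']
              exact Nat.pow_log_le_self 2 (by have := hs1 b hb; omega)
            have h6 := (Nat.mul_le_mul_left (B b).card h5).trans (hsB b hb)
            exact_mod_cast h6
          have h7 := Finset.sum_le_card_nsmul _ _ _ hb
          rw [nsmul_eq_mul] at h7
          refine h7.trans ((mul_le_mul_of_nonneg_right (hclass j hj') (by positivity)).trans_eq ?_)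
          rw [show (8 : ℝ) ^ j = 4 ^ j * 2 ^ j by rw [← mul_pow]; norm_num]
          field_simp
          norm_num
      _ = 3072 * x * (h : ℝ) ^ 3 / T ^ 4 * ∑ j ∈ Finset.range (Nat.log 2 h + 1), (4 : ℝ) ^ j := by
          rw [Finset.mul_sum]
      _ ≤ 3072 * x * (h : ℝ) ^ 3 / T ^ 4 * (2 * (h : ℝ) ^ 2) := by
          gcongr
          rw [geom_sum_eq (by norm_num)]
          have h5 : (2 : ℝ) ^ Nat.log 2 h ≤ h := by
            exact_mod_cast Nat.pow_log_le_self 2 (by omega)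
          have h6 : (4 : ℝ) ^ Nat.log 2 h = (2 ^ Nat.log 2 h) ^ 2 := by
            rw [← pow_mul, mul_comm, pow_mul]; norm_num
          have h7 : (4 : ℝ) ^ Nat.log 2 h ≤ (h : ℝ) ^ 2 := by
            rw [h6]; gcongr
          rw [pow_succ]
          linarith [sq_nonneg (h : ℝ)]
      _ = 6144 * x * (h : ℝ) ^ 5 / T ^ 4 := by ring
  rw [hcard, ← Finset.sum_filter_add_sum_filter_not R (fun b => 9 ≤ (B b).card)]
  have hbad : ∑ b ∈ R with ¬ 9 ≤ (B b).card, ((B b).card : ℝ) ≤ 8 * (2 * T / h + 1) := by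
    calc ∑ b ∈ R with ¬ 9 ≤ (B b).card, ((B b).card : ℝ)
        ≤ ∑ b ∈ R with ¬ 9 ≤ (B b).card, (8 : ℝ) := by
          refine Finset.sum_le_sum fun b hb => ?_
          have := (Finset.mem_filter.1 hb).2
          exact_mod_cast (by omega : (B b).card ≤ 8)
      _ ≤ ∑ b ∈ R, (8 : ℝ) :=
          Finset.sum_le_sum_of_subset_of_nonneg (Finset.filter_subset _ _) (by simp)
      _ = 8 * R.card := by rw [Finset.sum_const, nsmul_eq_mul, mul_comm]
      _ ≤ _ := by gcongr
  linarith

theorem le_mul_sub_of_hasSqMultiple {x T δ u v a b : ℝ} (hx : 0 < x) (hT : 0 < T) (hu : T ≤ u)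
    (huv : u < v) (hab : b + 1 ≤ a) (ha : a - x / u ^ 2 ≤ δ) (hb : 0 ≤ b - x / v ^ 2)
    (hδ : 2 * δ ≤ 1) : T ^ 3 ≤ 4 * x * (v - u) := by
  have hu0 := hT.trans_le hu
  have hv : T ≤ v := hu.trans huv.le
  have hv0 := hT.trans_le hv
  have e : x / u ^ 2 - x / v ^ 2 = x * (v - u) * (1 / (u * v * v) + 1 / (u * u * v)) := by
    field_simp
    ring
  have hd : 0 < v - u := sub_pos.2 huv
  have h1 : x * (v - u) * (1 / (u * v * v) + 1 / (u * u * v)) ≤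
      x * (v - u) * (1 / (T * T * T) + 1 / (T * T * T)) := by gcongr
  have h2 : x * (v - u) * (1 / (T * T * T) + 1 / (T * T * T)) = 2 * x * (v - u) / T ^ 3 := by
    field_simp
    ring
  have h3 : 1 / 2 ≤ 2 * x * (v - u) / T ^ 3 := by linarith
  rw [le_div_iff₀ (by positivity)] at h3
  linarith

theorem lt_of_sq_mul_mem {x y T : ℝ} {u v a b : ℕ} (hx : 0 < x) (hT : y ≤ T) (hu : T < u)
    (huv : u < v) (ha : x < (u : ℝ) ^ 2 * a) (hb : (v : ℝ) ^ 2 * b ≤ x + y) : b < a := by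
  by_contra! hab
  have ha0 : 0 < a := by
    rcases Nat.eq_zero_or_pos a with rfl | h
    · simp at ha; linarith
    · exact h
  have h1 : (u : ℝ) + 1 ≤ v := by exact_mod_cast huv
  have h2 : (a : ℝ) ≤ b := by exact_mod_cast hab
  have h3 : (1 : ℝ) ≤ a := by exact_mod_cast ha0
  have hu0 : (0 : ℝ) ≤ u := by positivity
  have h4 : ((u : ℝ) + 1) ^ 2 * a ≤ (v : ℝ) ^ 2 * b := by gcongr
  nlinarith [mul_le_mul_of_nonneg_left h3 hu0]

/-- Three integers whose squares have multiples in the same short interval are spread apart. -/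
theorem pow_four_le_of_three {x y T : ℝ} {u v w : ℕ} (hx : 0 < x) (hy : 0 < y) (hT : 1 ≤ T)
    (hxT : x ≤ T ^ 3) (hyT : 256 * y ≤ T) (hu : T < u) (huv : u < v) (hvw : v < w)
    (hw : (w : ℝ) ≤ 2 * T) (hu' : HasSqMultiple x y u) (hv' : HasSqMultiple x y v)
    (hw' : HasSqMultiple x y w) : T ^ 4 ≤ 6 * x * ((w : ℝ) - u) ^ 3 := by
  obtain ⟨a, ha, ha'⟩ := hu'
  obtain ⟨b, hb, hb'⟩ := hv'
  obtain ⟨c, hc, hc'⟩ := hw'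
  have hT0 : 0 < T := by linarith
  have ruv : (u : ℝ) < v := by exact_mod_cast huv
  have rvw : (v : ℝ) < w := by exact_mod_cast hvw
  have hab := lt_of_sq_mul_mem hx (by linarith) hu huv ha hb'
  have hbc := lt_of_sq_mul_mem hx (by linarith) (hu.trans ruv) hvw hb hc'
  have rab : (b : ℝ) + 1 ≤ a := by exact_mod_cast hab
  have rbc : (c : ℝ) + 1 ≤ b := by exact_mod_cast hbc
  obtain ⟨pa, pa'⟩ := sub_div_sq_bounds hT0 hu hy ha ha'
  obtain ⟨pb, pb'⟩ := sub_div_sq_bounds hT0 (hu.trans ruv) hy hb hb'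
  obtain ⟨pc, pc'⟩ := sub_div_sq_bounds hT0 (hu.trans (ruv.trans rvw)) hy hc hc'
  have hδ : 2 * (y / T ^ 2) ≤ 1 := by
    rw [← mul_div_assoc, div_le_one (by positivity)]
    nlinarith
  have hg1 := le_mul_sub_of_hasSqMultiple hx hT0 hu.le ruv rab pa' pb hδ
  have hg2 := le_mul_sub_of_hasSqMultiple hx hT0 (hu.trans ruv).le rvw rbc pb' pc hδ
  have hΔ := abs_second_difference_sub_le (hT0.trans hu) ruv rvw pa pa' pb pb' pc pc'
  have hG1 := sum_inv_div_le hT0 hu.le (hu.trans ruv).le (hu.trans (ruv.trans rvw)).le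
  have hG2 := le_sum_inv_div (hT0.trans hu) (hT0.trans (hu.trans ruv))
    (hT0.trans (hu.trans (ruv.trans rvw))) (by linarith) (rvw.le.trans hw) hw
  set G := (1 / (u : ℝ) + 1 / v + 1 / w) / (u * v * w)
  set p := (v : ℝ) - u with hp
  set q := (w : ℝ) - v with hq
  have hr : (w : ℝ) - u = p + q := by rw [hp, hq]; ring
  clear_value p q G
  rw [hr] at hΔ ⊢
  have hp0 : 0 < p := hp ▸ sub_pos.2 ruv
  have hq0 : 0 < q := hq ▸ sub_pos.2 rvw
  have hpq : T ^ 6 ≤ 16 * x ^ 2 * (p * q) := by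
    calc T ^ 6 = T ^ 3 * T ^ 3 := by ring
      _ ≤ (4 * x * p) * (4 * x * q) := by gcongr
      _ = _ := by ring
  have hlow : y / T ^ 2 < p * q * (x * G) := by
    have h1 : p * q * (x * (3 / (2 * T) ^ 4)) ≤ p * q * (x * G) := by gcongr
    refine lt_of_lt_of_le ?_ h1
    rw [show p * q * (x * (3 / (2 * T) ^ 4)) = 3 * x * (p * q) / (16 * T ^ 4) by
      field_simp; norm_num, div_lt_div_iff₀ (by positivity) (by positivity)]
    have h2 : 256 * y * x ≤ T ^ 4 := by
      calc 256 * y * x ≤ T * T ^ 3 := by gcongr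
        _ = T ^ 4 := by ring
    have h3 : x * (y * (16 * T ^ 4)) < x * (3 * x * (p * q) * T ^ 2) := by
      have h4 : T ^ 2 * T ^ 6 ≤ T ^ 2 * (16 * x ^ 2 * (p * q)) := by gcongr
      have h5 : (256 * y * x) * T ^ 4 ≤ T ^ 4 * T ^ 4 := by gcongr
      have h6 : 0 < T ^ 8 := by positivity
      linarith only [h4, h5, h6]
    exact lt_of_mul_lt_mul_left h3 hx.le
  have hmul : (p + q) * (y / T ^ 2) < (p + q) * (p * q * (x * G)) := by gcongr
  rw [abs_le] at hΔ
  have e1 : p * q * (p + q) * (x * G) = (p + q) * (p * q * (x * G)) := by ring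
  rw [e1] at hΔ
  have hpos : (0 : ℝ) < q * a - (p + q) * b + p * c := by linarith [hΔ.1]
  have hone : (1 : ℝ) ≤ q * a - (p + q) * b + p * c := by
    have hcast : q * a - (p + q) * b + p * c =
        (((w : ℤ) - v) * a - (w - u) * b + (v - u) * c : ℤ) := by
      rw [← hr, hp, hq]
      push_cast
      ring
    rw [hcast] at hpos ⊢
    exact_mod_cast Int.add_one_le_of_lt (Int.cast_pos.1 hpos)
  have hup : (p + q) * (p * q * (x * G)) ≤ (p + q) * (p * q * (x * (3 / T ^ 4))) := by gcongr
  have h7 : 1 ≤ 2 * ((p + q) * (p * q * (x * (3 / T ^ 4)))) := by linarith [hΔ.2]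
  have h8 : 2 * ((p + q) * (p * q * (x * (3 / T ^ 4)))) = 6 * x * ((p + q) * (p * q)) / T ^ 4 := by
    ring
  rw [h8, le_div_iff₀ (by positivity), one_mul] at h7
  refine h7.trans ?_
  have h9 : p * q ≤ (p + q) ^ 2 := by nlinarith only [hp0, hq0]
  calc 6 * x * ((p + q) * (p * q)) ≤ 6 * x * ((p + q) * (p + q) ^ 2) := by gcongr
    _ = 6 * x * (p + q) ^ 3 := by ring

theorem card_le_of_three_spread {S : Finset ℕ} {W M : ℝ} (hW : 0 < W)
    (hM : ∀ d ∈ S, (d : ℝ) ≤ M)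
    (h : ∀ u ∈ S, ∀ v ∈ S, ∀ w ∈ S, u < v → v < w → W ≤ (w : ℝ) - u) (hM0 : 0 ≤ M) :
    (S.card : ℝ) ≤ 2 * (M / W + 1) := by
  have hmaps : ∀ d ∈ S, ⌊(d : ℝ) / W⌋₊ ∈ Finset.range (⌊M / W⌋₊ + 1) := by
    intro d hd
    rw [Finset.mem_range, Nat.lt_succ_iff]
    have := hM d hd
    gcongr
  have hfib : ∀ b ∈ Finset.range (⌊M / W⌋₊ + 1),
      (S.filter fun d : ℕ => ⌊(d : ℝ) / W⌋₊ = b).card ≤ 2 := by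
    intro b _
    by_contra! hc
    let e := Finset.orderEmbOfCardLe (S.filter fun d : ℕ => ⌊(d : ℝ) / W⌋₊ = b) hc
    have he : ∀ i, e i ∈ S ∧ ⌊(e i : ℝ) / W⌋₊ = b := fun i =>
      Finset.mem_filter.1 (Finset.orderEmbOfCardLe_mem _ hc i)
    have h01 : e 0 < e 1 := e.strictMono (by decide)
    have h12 : e 1 < e 2 := e.strictMono (by decide)
    have h1 := h _ (he 0).1 _ (he 1).1 _ (he 2).1 h01 h12
    have h2 : (b : ℝ) ≤ (e 0 : ℝ) / W := by
      rw [← (he 0).2]; exact Nat.floor_le (by positivity)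
    have h3 : (e 2 : ℝ) / W < b + 1 := by
      rw [← (he 2).2]; exact Nat.lt_floor_add_one _
    rw [le_div_iff₀ hW] at h2
    rw [div_lt_iff₀ hW] at h3
    linarith
  have h1 := Finset.card_le_mul_card_image_of_maps_to hmaps 2 hfib
  rw [Finset.card_range] at h1
  have h2 : (⌊M / W⌋₊ : ℝ) ≤ M / W := Nat.floor_le (by positivity)
  have h3 : (S.card : ℝ) ≤ 2 * (⌊M / W⌋₊ + 1) := by exact_mod_cast h1
  linarith

theorem card_hasSqMultiple_le_of_le {z t y : ℝ} {S : Finset ℕ} (hz : 1 ≤ z) (ht : z ≤ t)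
    (hy : 0 < y) (hyz : 4096 * y ≤ z ^ 6)
    (hS : ∀ d ∈ S, t ^ 6 < d ∧ (d : ℝ) ≤ 2 * t ^ 6 ∧ HasSqMultiple (z ^ 18) y d) :
    (S.card : ℝ) ≤ 10 * z ^ 4 := by
  have hz0 : 0 < z := by linarith
  have ht0 : 0 < t := by linarith
  have ht6 : z ^ 6 ≤ t ^ 6 := by gcongr
  have hx : z ^ 18 ≤ (t ^ 6) ^ 3 := by rw [← pow_mul]; gcongr
  have h1 := card_le_of_three_spread (S := S) (W := t ^ 8 / (2 * z ^ 6)) (M := 2 * t ^ 6)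
    (by positivity) (fun d hd => (hS d hd).2.1) (fun u hu v hv w hw huv hvw => ?_) (by positivity)
  · have h2 : 2 * t ^ 6 / (t ^ 8 / (2 * z ^ 6)) ≤ 4 * z ^ 4 := by
      rw [div_div_eq_mul_div, div_le_iff₀ (by positivity)]
      calc 2 * t ^ 6 * (2 * z ^ 6) = 4 * z ^ 4 * (t ^ 6 * z ^ 2) := by ring
        _ ≤ 4 * z ^ 4 * (t ^ 6 * t ^ 2) := by gcongr
        _ = _ := by ring
    have h3 : 1 ≤ z ^ 4 := one_le_pow₀ hz
    linarith
  · have h2 := pow_four_le_of_three (by positivity) hy ((one_le_pow₀ hz).trans ht6) hx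
      (by linarith) (hS u hu).1 huv hvw (hS w hw).2.1 (hS u hu).2.2 (hS v hv).2.2 (hS w hw).2.2
    have huw : (0 : ℝ) ≤ (w : ℝ) - u := sub_nonneg.2 (by exact_mod_cast (huv.trans hvw).le)
    refine le_of_pow_le_pow_left₀ (n := 3) (by norm_num) huw ?_
    rw [div_pow, div_le_iff₀ (by positivity)]
    have h3 : 0 ≤ z ^ 18 * ((w : ℝ) - u) ^ 3 := by positivity
    calc (t ^ 8) ^ 3 = (t ^ 6) ^ 4 := by ring
      _ ≤ 6 * z ^ 18 * ((w : ℝ) - u) ^ 3 := h2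
      _ ≤ ((w : ℝ) - u) ^ 3 * (2 * z ^ 6) ^ 3 := by linarith

theorem card_hasSqMultiple_le_of_ge {z t y : ℝ} {S : Finset ℕ} (hz : 1 ≤ z) (ht0 : 0 < t)
    (ht : t ≤ z) (hy : 0 < y) (hyz : 4096 * y ≤ z ^ 6)
    (hS : ∀ d ∈ S, t ^ 6 < d ∧ (d : ℝ) ≤ 2 * t ^ 6 ∧ HasSqMultiple (z ^ 18) y d) :
    (S.card : ℝ) ≤ 264 * z ^ 4 := by
  have hz0 : 0 < z := by linarith
  have hz4 : 1 ≤ z ^ 4 := one_le_pow₀ hz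
  have htz : t * z ^ 3 ≤ z ^ 4 := by
    calc t * z ^ 3 ≤ z * z ^ 3 := by gcongr
      _ = z ^ 4 := by ring
  rcases lt_or_ge (t ^ 5 / (2 * z ^ 3)) 1 with hlt | hge
  · rw [div_lt_one (by positivity)] at hlt
    have h1 := card_le_of_sub_le (s := S) (W := t ^ 6) (by positivity)
      (fun a ha b hb _ => by linarith [(hS a ha).1, (hS b hb).2.1])
    have h2 : t ^ 6 ≤ 2 * (t * z ^ 3) := by
      calc t ^ 6 = t * t ^ 5 := by ring
        _ ≤ t * (2 * z ^ 3) := by gcongr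
        _ = _ := by ring
    linarith
  set h := ⌊t ^ 5 / (2 * z ^ 3)⌋₊ with hh
  have hh1 : 1 ≤ h := Nat.le_floor (by simpa using hge)
  have rh1 : (1 : ℝ) ≤ h := by exact_mod_cast hh1
  have hup : (h : ℝ) ≤ t ^ 5 / (2 * z ^ 3) := Nat.floor_le (by positivity)
  have hlo : t ^ 5 / (4 * z ^ 3) ≤ h := by
    have := Nat.lt_floor_add_one (t ^ 5 / (2 * z ^ 3))
    have e : t ^ 5 / (4 * z ^ 3) = t ^ 5 / (2 * z ^ 3) / 2 := by field_simp; norm_num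
    rw [← hh] at this
    linarith
  have ht3 : t ^ 3 ≤ z ^ 3 := by gcongr
  have hyt : y * t ^ 3 * 4096 ≤ z ^ 9 := by
    calc y * t ^ 3 * 4096 = (4096 * y) * t ^ 3 := by ring
      _ ≤ z ^ 6 * z ^ 3 := by gcongr
      _ = z ^ 9 := by ring
  have h3lo : t ^ 15 / (64 * z ^ 9) ≤ (h : ℝ) ^ 3 := by
    calc t ^ 15 / (64 * z ^ 9) = (t ^ 5 / (4 * z ^ 3)) ^ 3 := by field_simp; norm_num
      _ ≤ _ := by gcongr
  have key := card_hasSqMultiple_le (x := z ^ 18) (T := t ^ 6) (h := h) (S := S) (by positivity)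
    (by positivity) hy hh1 ?_ ?_ ?_ ?_ hS
  · have k1 : t ^ 6 / h ≤ 4 * z ^ 4 := by
      calc t ^ 6 / h ≤ t ^ 6 / (t ^ 5 / (4 * z ^ 3)) := by gcongr
        _ = 4 * (t * z ^ 3) := by field_simp
        _ ≤ 4 * z ^ 4 := by gcongr
    have k2 : 6144 * z ^ 18 * (h : ℝ) ^ 5 / (t ^ 6) ^ 4 ≤ 192 * z ^ 4 := by
      calc 6144 * z ^ 18 * (h : ℝ) ^ 5 / (t ^ 6) ^ 4
          ≤ 6144 * z ^ 18 * (t ^ 5 / (2 * z ^ 3)) ^ 5 / (t ^ 6) ^ 4 := by gcongr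
        _ = 192 * (t * z ^ 3) := by field_simp; norm_num
        _ ≤ 192 * z ^ 4 := by gcongr
    have k3 : 2 * t ^ 6 / h = 2 * (t ^ 6 / h) := by ring
    rw [k3] at key
    linarith
  · calc 16 * z ^ 18 * (h : ℝ) ^ 6 ≤ 16 * z ^ 18 * (t ^ 5 / (2 * z ^ 3)) ^ 6 := by gcongr
      _ = t ^ 30 / 4 := by field_simp; norm_num
      _ ≤ (t ^ 6) ^ 5 := by rw [← pow_mul]; linarith [pow_pos ht0 30]
  · calc 4 * y * (h : ℝ) ^ 3 ≤ 4 * y * (t ^ 5 / (2 * z ^ 3)) ^ 3 := by gcongr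
      _ = y * t ^ 3 / (2 * z ^ 9) * t ^ 12 := by field_simp; norm_num
      _ ≤ 1 * t ^ 12 := by
        gcongr
        rw [div_le_one (by positivity)]
        have : 0 < y * t ^ 3 := by positivity
        linarith
      _ = (t ^ 6) ^ 2 := by ring
  · calc 16 * y * (t ^ 6) ^ 2 = 16 * y * t ^ 12 := by ring
      _ ≤ (4096 * y) * z ^ 12 := by gcongr; norm_num
      _ ≤ z ^ 6 * z ^ 12 := by gcongr
      _ = z ^ 18 := by ring
  · calc 64 * y * (t ^ 6) ^ 3 = 64 * (y * t ^ 3) * t ^ 15 := by ring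
      _ ≤ 64 * (3 * z ^ 9 / 4096) * t ^ 15 := by
        gcongr
        rw [le_div_iff₀ (by norm_num)]
        linarith [pow_pos hz0 9]
      _ = 3 * z ^ 18 * (t ^ 15 / (64 * z ^ 9)) := by field_simp; norm_num
      _ ≤ _ := by gcongr

theorem card_hasSqMultiple_le_dyadic {z T y : ℝ} {S : Finset ℕ} (hz : 1 ≤ z) (hT : 0 < T)
    (hy : 0 < y) (hyz : 4096 * y ≤ z ^ 6)
    (hS : ∀ d ∈ S, T < d ∧ (d : ℝ) ≤ 2 * T ∧ HasSqMultiple (z ^ 18) y d) :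
    (S.card : ℝ) ≤ 264 * z ^ 4 := by
  obtain ⟨t, ht, rfl⟩ : ∃ t : ℝ, 0 < t ∧ t ^ 6 = T :=
    ⟨T ^ ((6 : ℕ) : ℝ)⁻¹, by positivity, Real.rpow_inv_natCast_pow hT.le (by norm_num)⟩
  rcases le_total t z with h | h
  · exact card_hasSqMultiple_le_of_ge hz ht h hy hyz hS
  · linarith [card_hasSqMultiple_le_of_le hz h hy hyz hS, pow_pos (zero_lt_one.trans_le hz) 4]

theorem card_le_of_dyadic {D A : ℝ} {P : ℕ → Prop} (hD : 0 < D)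
    (hA : ∀ T : ℝ, 0 < T → ∀ S : Finset ℕ, (∀ d ∈ S, T < d ∧ (d : ℝ) ≤ 2 * T ∧ P d) →
      (S.card : ℝ) ≤ A) (n : ℕ) :
    ∀ S : Finset ℕ, (∀ d ∈ S, D < d ∧ (d : ℝ) ≤ 2 ^ n * D ∧ P d) → (S.card : ℝ) ≤ n * A := by
  induction n with
  | zero =>
    intro S hS
    have : S = ∅ := Finset.eq_empty_of_forall_notMem fun d hd => by
      have := hS d hd
      rw [pow_zero, one_mul] at this
      linarith
    simp [this]
  | succ n ih =>
    intro S hS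
    have h1 := ih (S.filter fun d => (d : ℝ) ≤ 2 ^ n * D) fun d hd => by
      obtain ⟨hd, hd'⟩ := Finset.mem_filter.1 hd
      exact ⟨(hS d hd).1, hd', (hS d hd).2.2⟩
    have h2 := hA (2 ^ n * D) (by positivity) (S.filter fun d => ¬ (d : ℝ) ≤ 2 ^ n * D)
      fun d hd => by
        obtain ⟨hd, hd'⟩ := Finset.mem_filter.1 hd
        refine ⟨not_le.1 hd', ?_, (hS d hd).2.2⟩
        have := (hS d hd).2.1
        rw [pow_succ] at this
        linarith
    have h3 := Finset.card_filter_add_card_filter_not (s := S) fun d : ℕ => (d : ℝ) ≤ 2 ^ n * D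
    rw [← h3]
    push_cast
    linarith

theorem card_hasSqMultiple_le_log {x y : ℝ} {S : Finset ℕ} (hx : 2 ≤ x) (hy : 0 < y)
    (hyx : 4096 * y ≤ x ^ ((1 : ℝ) / 3))
    (hS : ∀ d ∈ S, x ^ ((2 : ℝ) / 9) < d ∧ HasSqMultiple x y d) :
    (S.card : ℝ) ≤ 1056 * x ^ ((2 : ℝ) / 9) * Real.log x := by
  have hx0 : 0 < x := by linarith
  set z := x ^ ((18 : ℕ) : ℝ)⁻¹ with hz
  have hz18 : z ^ 18 = x := Real.rpow_inv_natCast_pow hx0.le (by norm_num)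
  have hz1 : 1 ≤ z := Real.one_le_rpow (by linarith) (by positivity)
  have hz0 : 0 < z := by linarith
  have hz6 : x ^ ((1 : ℝ) / 3) = z ^ 6 := by
    rw [hz, ← Real.rpow_natCast, ← Real.rpow_mul hx0.le]
    norm_num
  have hz4 : x ^ ((2 : ℝ) / 9) = z ^ 4 := by
    rw [hz, ← Real.rpow_natCast, ← Real.rpow_mul hx0.le]
    norm_num
  have hlogz : Real.log x = 18 * Real.log z := by rw [← hz18, Real.log_pow]; norm_num
  rw [hz6] at hyx
  rw [hz4] at hS ⊢
  set n := Nat.log 2 ⌊2 * z ^ 5⌋₊ + 1 with hn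
  have hn1 : 2 * z ^ 5 ≤ 2 ^ n := by
    have h1 := Nat.lt_pow_succ_log_self one_lt_two ⌊2 * z ^ 5⌋₊
    have h2 := Nat.lt_floor_add_one (2 * z ^ 5)
    have h3 : (⌊2 * z ^ 5⌋₊ : ℝ) + 1 ≤ 2 ^ n := by exact_mod_cast h1
    linarith
  have hn2 : (n : ℝ) ≤ 4 * Real.log x := by
    have h1 : (2 : ℝ) ^ (n - 1) ≤ 2 * z ^ 5 := by
      have h2 : ⌊2 * z ^ 5⌋₊ ≠ 0 := by
        have : 1 ≤ ⌊2 * z ^ 5⌋₊ := Nat.le_floor (by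
          have := one_le_pow₀ (n := 5) hz1
          push_cast
          linarith)
        omega
      have h3 := Nat.pow_log_le_self 2 h2
      calc (2 : ℝ) ^ (n - 1) ≤ ⌊2 * z ^ 5⌋₊ := by exact_mod_cast h3
        _ ≤ _ := Nat.floor_le (by positivity)
    have h4 := Real.log_le_log (by positivity) h1
    rw [Real.log_pow, Real.log_mul (by norm_num) (by positivity), Real.log_pow, hn] at h4
    push_cast [Nat.add_sub_cancel] at h4
    have h5 := Real.log_two_gt_d9
    have h6 : Real.log 2 ≤ Real.log x := Real.log_le_log (by norm_num) hx
    have h7 : (n : ℝ) = Nat.log 2 ⌊2 * z ^ 5⌋₊ + 1 := by rw [hn]; push_cast; ring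
    rw [h7]
    have h8 : (0 : ℝ) ≤ Nat.log 2 ⌊2 * z ^ 5⌋₊ := by positivity
    nlinarith [mul_le_mul_of_nonneg_right h5.le h8]
  have hle : (S.card : ℝ) ≤ n * (264 * z ^ 4) := by
    refine card_le_of_dyadic (P := HasSqMultiple (z ^ 18) y) (D := z ^ 4) (by positivity)
      (fun T hT S hS => card_hasSqMultiple_le_dyadic hz1 hT hy hyx hS) n S fun d hd => ?_
    obtain ⟨h1, h2⟩ := hS d hd
    rw [hz18]
    refine ⟨h1, ?_, h2⟩
    obtain ⟨m, hm1, hm2⟩ := h2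
    have hm0 : (1 : ℝ) ≤ m := by
      rcases Nat.eq_zero_or_pos m with rfl | h
      · simp at hm1; linarith
      · exact_mod_cast h
    have h3 : z ^ 6 ≤ z ^ 18 := pow_le_pow_right₀ hz1 (by norm_num)
    have h4 : (d : ℝ) ^ 2 ≤ (2 * z ^ 9) ^ 2 := by
      have h5 : (d : ℝ) ^ 2 ≤ (d : ℝ) ^ 2 * m := le_mul_of_one_le_right (by positivity) hm0
      have h6 : (2 * z ^ 9) ^ 2 = 4 * z ^ 18 := by ring
      rw [h6, hz18]
      rw [hz18] at h3
      linarith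
    have h5 := le_of_pow_le_pow_left₀ (by norm_num) (by positivity) h4
    calc (d : ℝ) ≤ 2 * z ^ 9 := h5
      _ = (2 * z ^ 5) * z ^ 4 := by ring
      _ ≤ _ := by gcongr
  calc (S.card : ℝ) ≤ n * (264 * z ^ 4) := hle
    _ ≤ (4 * Real.log x) * (264 * z ^ 4) := by gcongr
    _ = _ := by ring

open ArithmeticFunction in
theorem sum_moebius_sq_dvd {k M : ℕ} (hk : 0 < k) (hM : k ≤ M) :
    ∑ d ∈ (Finset.Ioc 0 M).filter (fun d => d ^ 2 ∣ k), moebius d =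
      if Squarefree k then 1 else 0 := by
  obtain ⟨a, b, rfl, ha⟩ := Nat.sq_mul_squarefree k
  have hb : b ≠ 0 := by rintro rfl; simp at hk
  have ha0 : 0 < a := Nat.pos_of_ne_zero ha.ne_zero
  have hdvd : ∀ d : ℕ, d ^ 2 ∣ b ^ 2 * a → d ∣ b := by
    intro d hd
    have hg : 0 < Nat.gcd d b := Nat.gcd_pos_of_pos_right _ (Nat.pos_of_ne_zero hb)
    obtain ⟨d', b', hcop, hd', hb'⟩ := Nat.exists_coprime d b
    set g := Nat.gcd d b
    rw [hd', hb', mul_pow, mul_pow, mul_right_comm] at hd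
    have h1 : d' ^ 2 ∣ b' ^ 2 * a := Nat.dvd_of_mul_dvd_mul_right (by positivity) hd
    have h2 : d' ^ 2 ∣ a := (Nat.Coprime.pow 2 2 hcop).dvd_of_dvd_mul_left h1
    rw [sq] at h2
    have h3 : d' = 1 := Nat.isUnit_iff.1 (ha d' h2)
    rw [hd', hb', h3, one_mul]
    exact dvd_mul_left _ _
  have hset : (Finset.Ioc 0 M).filter (fun d => d ^ 2 ∣ b ^ 2 * a) = b.divisors := by
    ext d
    rw [Finset.mem_filter, Finset.mem_Ioc, Nat.mem_divisors]
    constructor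
    · rintro ⟨-, h⟩
      exact ⟨hdvd d h, hb⟩
    · rintro ⟨h, -⟩
      refine ⟨⟨Nat.pos_of_dvd_of_pos h (Nat.pos_of_ne_zero hb), ?_⟩,
        (pow_dvd_pow_of_dvd h 2).mul_right a⟩
      calc d ≤ b := Nat.le_of_dvd (Nat.pos_of_ne_zero hb) h
        _ ≤ b ^ 2 := Nat.le_self_pow (by norm_num) b
        _ ≤ b ^ 2 * a := Nat.le_mul_of_pos_right _ ha0
        _ ≤ M := hM
  have hsq : Squarefree (b ^ 2 * a) ↔ b = 1 := by
    constructor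
    · intro h
      exact Nat.isUnit_iff.1 (h b (by rw [sq]; exact dvd_mul_right _ _))
    · rintro rfl
      simpa using ha
  rw [hset, ← coe_mul_zeta_apply, moebius_mul_coe_zeta, one_apply]
  by_cases h : b = 1 <;> simp [h, hsq, ha]

open ArithmeticFunction in
theorem sum_squarefree_eq {n M : ℕ} (hM : n ≤ M) :
    ∑ k ∈ Finset.Ioc 0 n, (if Squarefree k then (1 : ℝ) else 0) =
      ∑ d ∈ Finset.Ioc 0 M, (moebius d : ℝ) * ((n / d ^ 2 : ℕ) : ℝ) := by
  have h1 : ∀ k ∈ Finset.Ioc 0 n, (if Squarefree k then (1 : ℝ) else 0) =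
      ∑ d ∈ Finset.Ioc 0 M, if d ^ 2 ∣ k then (moebius d : ℝ) else 0 := by
    intro k hk
    rw [Finset.mem_Ioc] at hk
    have := congrArg (Int.cast (R := ℝ)) (sum_moebius_sq_dvd hk.1 (hk.2.trans hM))
    rw [Finset.sum_filter] at this
    push_cast at this
    rw [← this]
  rw [Finset.sum_congr rfl h1, Finset.sum_comm]
  refine Finset.sum_congr rfl fun d _ => ?_
  rw [← Finset.sum_filter, Finset.sum_const, Nat.Ioc_filter_dvd_card_eq_div, nsmul_eq_mul, mul_comm]

open ArithmeticFunction in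
theorem hasSum_moebius_div_sq :
    HasSum (fun d : ℕ => (moebius d : ℝ) * ((d : ℝ) ^ 2)⁻¹) (6 / Real.pi ^ 2) := by
  have h2 : 1 < (2 : ℂ).re := by norm_num
  have hs : LSeriesSummable (fun n => (moebius n : ℂ)) 2 := LSeriesSummable_moebius_iff.2 h2
  have hv := LSeries_one_mul_Lseries_moebius h2
  rw [LSeries_one_eq_riemannZeta h2, riemannZeta_two] at hv
  have hsum := hs.hasSum
  rw [show ∑' n, LSeries.term (fun n => (moebius n : ℂ)) 2 n =
    LSeries (fun n => (moebius n : ℂ)) 2 from rfl] at hsum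
  have hpi : (Real.pi : ℂ) ≠ 0 := by exact_mod_cast Real.pi_ne_zero
  have hval : LSeries (fun n => (moebius n : ℂ)) 2 = ((6 / Real.pi ^ 2 : ℝ) : ℂ) := by
    push_cast
    field_simp at hv ⊢
    linear_combination hv
  rw [hval] at hsum
  rw [← Complex.hasSum_ofReal]
  refine hsum.congr_fun fun n => ?_
  rw [LSeries.term_of_ne_zero' two_ne_zero, div_eq_mul_inv]
  push_cast
  rw [← Complex.cpow_ofNat]

open ArithmeticFunction in
theorem abs_sum_moebius_div_sq_sub_le (K : ℕ) :
    |∑ d ∈ Finset.Ioc 0 K, (moebius d : ℝ) * ((d : ℝ) ^ 2)⁻¹ - 6 / Real.pi ^ 2| ≤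
      2 / ((K : ℝ) + 1) := by
  have hlim := (Filter.Tendsto.const_sub
    (∑ d ∈ Finset.Ioc 0 K, (moebius d : ℝ) * ((d : ℝ) ^ 2)⁻¹)
    hasSum_moebius_div_sq.tendsto_sum_nat).abs
  refine le_of_tendsto hlim ?_
  filter_upwards [Filter.eventually_ge_atTop (K + 1)] with n hn
  have h0 : Finset.range (K + 1) = insert 0 (Finset.Ioc 0 K) := by
    ext i
    simp only [Finset.mem_range, Finset.mem_insert, Finset.mem_Ioc]
    omega
  have h1 : ∑ d ∈ Finset.Ioc 0 K, (moebius d : ℝ) * ((d : ℝ) ^ 2)⁻¹ =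
      ∑ d ∈ Finset.range (K + 1), (moebius d : ℝ) * ((d : ℝ) ^ 2)⁻¹ := by
    rw [h0, Finset.sum_insert (by simp)]
    simp
  have h2 : Finset.Ico (K + 1) n = Finset.Ioo K n := by
    ext i
    simp only [Finset.mem_Ico, Finset.mem_Ioo]
    omega
  rw [h1, abs_sub_comm, ← Finset.sum_Ico_eq_sub _ hn, h2]
  refine (Finset.abs_sum_le_sum_abs _ _).trans (le_trans ?_ (sum_Ioo_inv_sq_le K n))
  refine Finset.sum_le_sum fun d _ => ?_
  rw [abs_mul, abs_of_nonneg (by positivity : (0 : ℝ) ≤ ((d : ℝ) ^ 2)⁻¹)]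
  refine mul_le_of_le_one_left (by positivity) ?_
  exact_mod_cast abs_moebius_le_one (n := d)

theorem abs_floor_div_sub_lt {x y : ℝ} (hx : 0 ≤ x) (hy : 0 ≤ y) (d : ℕ) :
    |((⌊x + y⌋₊ / d : ℕ) : ℝ) - ((⌊x⌋₊ / d : ℕ) : ℝ) - y * (d : ℝ)⁻¹| < 1 := by
  rw [← Nat.floor_div_natCast, ← Nat.floor_div_natCast, abs_lt]
  have h1 := Nat.floor_le (by positivity : 0 ≤ (x + y) / d)
  have h2 := Nat.floor_le (by positivity : 0 ≤ x / d)
  have h3 := Nat.lt_floor_add_one ((x + y) / d)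
  have h4 := Nat.lt_floor_add_one (x / d)
  have h5 : (x + y) / d = x / d + y * (d : ℝ)⁻¹ := by ring
  rw [h5] at h1 h3 ⊢
  constructor <;> linarith

theorem hasSqMultiple_of_floor_div_lt {x y : ℝ} {d : ℕ} (hxy : 0 ≤ x + y) (hd : 0 < d)
    (h : ⌊x⌋₊ / d ^ 2 < ⌊x + y⌋₊ / d ^ 2) : HasSqMultiple x y d := by
  refine ⟨⌊x + y⌋₊ / d ^ 2, ?_, ?_⟩
  · rw [Nat.div_lt_iff_lt_mul (by positivity), mul_comm] at h
    exact_mod_cast (Nat.lt_of_floor_lt h)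
  · have h1 := Nat.mul_div_le ⌊x + y⌋₊ (d ^ 2)
    exact le_trans (by exact_mod_cast h1) (Nat.floor_le hxy)

open ArithmeticFunction in
theorem abs_sum_squarefree_sub_le {x y : ℝ} (hx : 2 ≤ x) (hy : 0 < y)
    (hyx : 4096 * y ≤ x ^ ((1 : ℝ) / 3)) :
    |∑ k ∈ Finset.Ioc 0 ⌊x + y⌋₊, (if Squarefree k then (1 : ℝ) else 0) -
        ∑ k ∈ Finset.Ioc 0 ⌊x⌋₊, (if Squarefree k then (1 : ℝ) else 0) - y * (6 / Real.pi ^ 2)| ≤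
      1062 * x ^ ((2 : ℝ) / 9) * Real.log x := by
  set D := x ^ ((2 : ℝ) / 9) with hD
  have hD1 : 1 ≤ D := Real.one_le_rpow (by linarith) (by norm_num)
  have hyD : y ≤ D ^ 2 := by
    have h1 : D ^ 2 = x ^ ((4 : ℝ) / 9) := by
      rw [hD, ← Real.rpow_natCast, ← Real.rpow_mul (by linarith)]
      norm_num
    rw [h1]
    have h2 : x ^ ((1 : ℝ) / 3) ≤ x ^ ((4 : ℝ) / 9) :=
      Real.rpow_le_rpow_of_exponent_le (by linarith) (by norm_num)
    linarith
  set K := ⌊D⌋₊ with hK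
  set n := ⌊x + y⌋₊ with hn
  set m := ⌊x⌋₊ with hm
  have hmn : m ≤ n := Nat.floor_mono (by linarith)
  rw [sum_squarefree_eq (Nat.le_add_right n K), sum_squarefree_eq (hmn.trans (Nat.le_add_right n K)),
    ← Finset.sum_sub_distrib]
  set N : ℕ → ℝ := fun d => ((n / d ^ 2 : ℕ) : ℝ) - ((m / d ^ 2 : ℕ) : ℝ) with hN
  have hμ : ∀ d, |(moebius d : ℝ)| ≤ 1 := fun d => by exact_mod_cast abs_moebius_le_one (n := d)
  have hNd : ∀ d, |N d - y * ((d : ℝ) ^ 2)⁻¹| < 1 := fun d => by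
    have := abs_floor_div_sub_lt (x := x) (by linarith) hy.le (d ^ 2)
    push_cast at this
    exact this
  have hsplit : ∑ d ∈ Finset.Ioc 0 (n + K), ((moebius d : ℝ) * ((n / d ^ 2 : ℕ) : ℝ) -
      (moebius d : ℝ) * ((m / d ^ 2 : ℕ) : ℝ)) - y * (6 / Real.pi ^ 2) =
      ∑ d ∈ Finset.Ioc 0 K, (moebius d : ℝ) * (N d - y * ((d : ℝ) ^ 2)⁻¹) +
      y * (∑ d ∈ Finset.Ioc 0 K, (moebius d : ℝ) * ((d : ℝ) ^ 2)⁻¹ - 6 / Real.pi ^ 2) +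
      ∑ d ∈ Finset.Ioc K (n + K), (moebius d : ℝ) * N d := by
    rw [← Finset.sum_Ioc_consecutive _ (Nat.zero_le K) (Nat.le_add_left K n), mul_sub,
      Finset.mul_sum]
    simp_rw [← mul_sub]
    have : ∑ d ∈ Finset.Ioc 0 K, (moebius d : ℝ) * (N d - y * ((d : ℝ) ^ 2)⁻¹) =
        ∑ d ∈ Finset.Ioc 0 K, (moebius d : ℝ) * N d -
          ∑ d ∈ Finset.Ioc 0 K, y * ((moebius d : ℝ) * ((d : ℝ) ^ 2)⁻¹) := by
      rw [← Finset.sum_sub_distrib]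
      exact Finset.sum_congr rfl fun d _ => by ring
    rw [this]
    ring
  rw [hsplit]
  have b1 : |∑ d ∈ Finset.Ioc 0 K, (moebius d : ℝ) * (N d - y * ((d : ℝ) ^ 2)⁻¹)| ≤ D := by
    refine (Finset.abs_sum_le_sum_abs _ _).trans ?_
    have h1 : ∀ d ∈ Finset.Ioc 0 K, |(moebius d : ℝ) * (N d - y * ((d : ℝ) ^ 2)⁻¹)| ≤ 1 := by
      intro d _
      rw [abs_mul]
      exact mul_le_one₀ (hμ d) (abs_nonneg _) (hNd d).le
    have h2 := Finset.sum_le_card_nsmul _ _ _ h1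
    rw [nsmul_eq_mul, mul_one, Nat.card_Ioc, Nat.sub_zero] at h2
    exact h2.trans (Nat.floor_le (by linarith))
  have b2 : |y * (∑ d ∈ Finset.Ioc 0 K, (moebius d : ℝ) * ((d : ℝ) ^ 2)⁻¹ - 6 / Real.pi ^ 2)| ≤
      2 * D := by
    rw [abs_mul, abs_of_pos hy]
    calc y * |∑ d ∈ Finset.Ioc 0 K, (moebius d : ℝ) * ((d : ℝ) ^ 2)⁻¹ - 6 / Real.pi ^ 2|
        ≤ D ^ 2 * (2 / D) := by
          gcongr
          refine (abs_sum_moebius_div_sq_sub_le K).trans ?_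
          gcongr
          exact (Nat.lt_floor_add_one D).le
      _ = 2 * D := by field_simp
  have hlarge : ∀ d ∈ Finset.Ioc K (n + K), D < d := fun d hd =>
    Nat.lt_of_floor_lt (Finset.mem_Ioc.1 hd).1
  have b3 : |∑ d ∈ Finset.Ioc K (n + K), (moebius d : ℝ) * N d| ≤ 1056 * D * Real.log x := by
    set S := (Finset.Ioc K (n + K)).filter fun d => HasSqMultiple x y d with hS
    have h1 : ∀ d ∈ Finset.Ioc K (n + K), |(moebius d : ℝ) * N d| ≤
        if HasSqMultiple x y d then 1 else 0 := by
      intro d hd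
      have hdD := hlarge d hd
      have hd0 : (0 : ℝ) < d := by linarith
      have hle : m / d ^ 2 ≤ n / d ^ 2 := Nat.div_le_div_right hmn
      have hone : n / d ^ 2 ≤ m / d ^ 2 + 1 := by
        have h2 := (abs_lt.1 (hNd d)).2
        have h3 : y * ((d : ℝ) ^ 2)⁻¹ ≤ 1 := by
          rw [← div_eq_mul_inv, div_le_one (by positivity)]
          exact hyD.trans (by gcongr)
        have h4 : ((n / d ^ 2 : ℕ) : ℝ) < ((m / d ^ 2 + 2 : ℕ) : ℝ) := by
          push_cast
          simp only [hN] at h2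
          linarith
        have h5 := Nat.cast_lt.1 h4
        omega
      rcases hle.eq_or_lt with h2 | h2
      · have : N d = 0 := by simp only [hN, h2, sub_self]
        rw [this, mul_zero, abs_zero]
        split_ifs <;> norm_num
      · rw [if_pos (hasSqMultiple_of_floor_div_lt (by linarith) (by exact_mod_cast hd0) h2)]
        have : N d = 1 := by
          have h3 : n / d ^ 2 = m / d ^ 2 + 1 := by omega
          simp only [hN, h3]
          push_cast
          ring
        rw [this, mul_one]
        exact hμ d
    refine (Finset.abs_sum_le_sum_abs _ _).trans ((Finset.sum_le_sum h1).trans ?_)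
    rw [← Finset.sum_filter, Finset.sum_const, nsmul_eq_mul, mul_one]
    refine card_hasSqMultiple_le_log hx hy hyx fun d hd => ?_
    obtain ⟨hd, hd'⟩ := Finset.mem_filter.1 hd
    exact ⟨hlarge d hd, hd'⟩
  have hlog : 1 ≤ 2 * Real.log x := by
    have := Real.log_two_gt_d9
    have := Real.log_le_log (by norm_num) hx
    linarith
  have hDlog : D ≤ D * (2 * Real.log x) := le_mul_of_one_le_right (by linarith) hlog
  refine (abs_add_three _ _ _).trans ?_
  linarith

theorem abs_sum_squarefree_sub_le_of_le {x y : ℝ} (hx : 2 ≤ x) (hy : 0 < y)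
    (hyx : y ≤ x ^ ((1 : ℝ) / 3)) :
    |∑ k ∈ Finset.Ioc 0 ⌊x + y⌋₊, (if Squarefree k then (1 : ℝ) else 0) -
        ∑ k ∈ Finset.Ioc 0 ⌊x⌋₊, (if Squarefree k then (1 : ℝ) else 0) - y * (6 / Real.pi ^ 2)| ≤
      4096 * 4248 * x ^ ((2 : ℝ) / 9) * Real.log x := by
  set w := y / 4096 with hw
  have hw0 : 0 < w := by positivity
  have hy2 : y ≤ x := hyx.trans (by
    conv_rhs => rw [← Real.rpow_one x]
    exact Real.rpow_le_rpow_of_exponent_le (by linarith) (by norm_num))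
  set f : ℕ → ℝ := fun i => ∑ k ∈ Finset.Ioc 0 ⌊x + i * w⌋₊, (if Squarefree k then (1 : ℝ) else 0) -
    i * w * (6 / Real.pi ^ 2) with hf
  have hstep : ∀ i ∈ Finset.range 4096,
      |f (i + 1) - f i| ≤ 4248 * x ^ ((2 : ℝ) / 9) * Real.log x := by
    intro i hi
    have hi' : (i : ℝ) ≤ 4096 := by exact_mod_cast (Finset.mem_range.1 hi).le
    have hiw : 0 ≤ i * w := by positivity
    have hiw' : i * w ≤ y := by
      calc i * w ≤ 4096 * w := by gcongr
        _ = y := by rw [hw]; ring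
    have h1 := abs_sum_squarefree_sub_le (x := x + i * w) (y := w) (by linarith) hw0 (by
      calc 4096 * w = y := by rw [hw]; ring
        _ ≤ x ^ ((1 : ℝ) / 3) := hyx
        _ ≤ _ := by gcongr; linarith)
    have h2 : f (i + 1) - f i = ∑ k ∈ Finset.Ioc 0 ⌊x + i * w + w⌋₊,
        (if Squarefree k then (1 : ℝ) else 0) - ∑ k ∈ Finset.Ioc 0 ⌊x + i * w⌋₊,
        (if Squarefree k then (1 : ℝ) else 0) - w * (6 / Real.pi ^ 2) := by
      simp only [hf]
      push_cast
      rw [show x + ((i : ℝ) + 1) * w = x + i * w + w by ring]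
      ring
    rw [h2]
    refine h1.trans ?_
    have h3 : (x + i * w) ^ ((2 : ℝ) / 9) ≤ 2 * x ^ ((2 : ℝ) / 9) := by
      calc (x + i * w) ^ ((2 : ℝ) / 9) ≤ (2 * x) ^ ((2 : ℝ) / 9) := by
            gcongr
            linarith
        _ = 2 ^ ((2 : ℝ) / 9) * x ^ ((2 : ℝ) / 9) := Real.mul_rpow (by norm_num) (by linarith)
        _ ≤ 2 ^ (1 : ℝ) * x ^ ((2 : ℝ) / 9) := by
            gcongr
            · norm_num
            · norm_num
        _ = _ := by rw [Real.rpow_one]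
    have h4 : Real.log (x + i * w) ≤ 2 * Real.log x := by
      rw [show 2 * Real.log x = Real.log (x ^ 2) by rw [Real.log_pow]; norm_num]
      exact Real.log_le_log (by linarith) (by nlinarith)
    have h5 : 0 ≤ Real.log (x + i * w) := Real.log_nonneg (by linarith)
    calc 1062 * (x + i * w) ^ ((2 : ℝ) / 9) * Real.log (x + i * w)
        ≤ 1062 * (2 * x ^ ((2 : ℝ) / 9)) * (2 * Real.log x) := by gcongr
      _ = _ := by ring
  have htel : ∑ k ∈ Finset.Ioc 0 ⌊x + y⌋₊, (if Squarefree k then (1 : ℝ) else 0) -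
      ∑ k ∈ Finset.Ioc 0 ⌊x⌋₊, (if Squarefree k then (1 : ℝ) else 0) - y * (6 / Real.pi ^ 2) =
      ∑ i ∈ Finset.range 4096, (f (i + 1) - f i) := by
    rw [Finset.sum_range_sub]
    simp only [hf]
    push_cast
    rw [show (4096 : ℝ) * w = y by rw [hw]; ring, zero_mul, add_zero]
    ring
  rw [htel]
  refine (Finset.abs_sum_le_sum_abs _ _).trans ((Finset.sum_le_card_nsmul _ _ _ hstep).trans ?_)
  rw [Finset.card_range, nsmul_eq_mul]
  push_cast
  linarith

theorem stmt_18 :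
    ∃ C : ℝ, 0 < C ∧
      ∀ x y : ℝ, 2 ≤ x → 16 ≤ y → y ≤ x ^ ((1:ℝ)/3) →
        |(∑ n ∈ Finset.Ioc ⌊x⌋ ⌊x + y⌋, (if Squarefree n then (1:ℝ) else 0))
            - y / (Real.pi ^ 2 / 6)| ≤ C * x ^ ((2:ℝ)/9) * Real.log x := by
  refine ⟨4096 * 4248, by norm_num, fun x y hx hy hyx => ?_⟩
  have key := abs_sum_squarefree_sub_le_of_le hx (by linarith) hyx
  have hmn : ⌊x⌋₊ ≤ ⌊x + y⌋₊ := Nat.floor_mono (by linarith)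
  have h1 : ∑ n ∈ Finset.Ioc ⌊x⌋ ⌊x + y⌋, (if Squarefree n then (1 : ℝ) else 0) =
      ∑ k ∈ Finset.Ioc ⌊x⌋₊ ⌊x + y⌋₊, (if Squarefree k then (1 : ℝ) else 0) := by
    rw [← Int.natCast_floor_eq_floor (by linarith : 0 ≤ x),
      ← Int.natCast_floor_eq_floor (by linarith : 0 ≤ x + y)]
    symm
    refine Finset.sum_bij (fun k _ => (k : ℤ)) (fun k hk => ?_) (fun k _ l _ h => by
      exact_mod_cast h) (fun k hk => ?_) (fun k _ => ?_)
    · rw [Finset.mem_Ioc] at hk ⊢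
      omega
    · rw [Finset.mem_Ioc] at hk
      exact ⟨k.toNat, by rw [Finset.mem_Ioc]; omega, by omega⟩
    · simp only [Int.squarefree_natCast]
  have h2 := Finset.sum_Ioc_consecutive (fun k : ℕ => if Squarefree k then (1 : ℝ) else 0)
    (Nat.zero_le _) hmn
  have h3 : y / (Real.pi ^ 2 / 6) = y * (6 / Real.pi ^ 2) := by rw [div_eq_mul_inv, inv_div]
  rw [h1, h3]
  rwa [← h2, add_sub_cancel_left] at key
end

section
/- There exists a constant c₀ > 0 such that for all sufficiently large real x, every real y with c₀·x^{2/9}·log x ≤ y < (1/4)·√x has the property that the interval [x, x+y] contains a squarefree integer. -/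
/-- The remainder `m - x / d ^ 2` when `m * d ^ 2` lies in `[x, x + y]` and `D ≤ d`. -/
lemma sub_div_sq_mem {x y D d m : ℝ} (hD : 0 < D) (hy : 0 ≤ y) (hd : D ≤ d)
    (h₁ : x ≤ m * d ^ 2) (h₂ : m * d ^ 2 ≤ x + y) :
    0 ≤ m - x / d ^ 2 ∧ m - x / d ^ 2 ≤ y / D ^ 2 := by
  have hd0 : 0 < d := hD.trans_le hd
  have e : m - x / d ^ 2 = (m * d ^ 2 - x) / d ^ 2 := by field_simp
  rw [e]
  refine ⟨div_nonneg (by linarith) (by positivity), ?_⟩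
  calc (m * d ^ 2 - x) / d ^ 2 ≤ y / d ^ 2 := by gcongr; linarith
    _ ≤ y / D ^ 2 := by gcongr

lemma not_three_close {x y D g : ℝ} {p q r mp mq mr : ℤ} (hD : 0 < D) (hx : 0 < x) (hy : 0 ≤ y)
    (hg : 0 < g) (hp : D ≤ p) (hr : (r : ℝ) ≤ 2 * D) (hpq : p + g ≤ q) (hqr : q + g ≤ r)
    (hp₁ : x ≤ mp * p ^ 2) (hp₂ : mp * p ^ 2 ≤ x + y)
    (hq₁ : x ≤ mq * q ^ 2) (hq₂ : mq * q ^ 2 ≤ x + y)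
    (hr₁ : x ≤ mr * r ^ 2) (hr₂ : mr * r ^ 2 ≤ x + y)
    (hDy : 16 * y * D ^ 2 < 3 * g ^ 2 * x) (ha : x * (r - p) ^ 3 ≤ D ^ 4)
    (hay : (r - p) * y < D ^ 2 / 4) : False := by
  obtain ⟨α₀, α₁⟩ := sub_div_sq_mem (d := p) (m := mp) hD hy hp (by exact_mod_cast hp₁)
    (by exact_mod_cast hp₂)
  obtain ⟨β₀, β₁⟩ := sub_div_sq_mem (d := q) (m := mq) hD hy (by linarith) (by exact_mod_cast hq₁)
    (by exact_mod_cast hq₂)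
  obtain ⟨γ₀, γ₁⟩ := sub_div_sq_mem (d := r) (m := mr) hD hy (by linarith) (by exact_mod_cast hr₁)
    (by exact_mod_cast hr₂)
  set I : ℤ := mp * (r - q) - mq * (r - p) + mr * (q - p) with hI
  have hIr : (I : ℝ) = mp * (r - q) - mq * (r - p) + mr * (q - p) := by rw [hI]; push_cast; ring
  clear_value I
  generalize (p : ℝ) = P at *
  generalize (q : ℝ) = Q at *
  generalize (r : ℝ) = R at *
  have hP0 : 0 < P := by linarith
  have hQ0 : 0 < Q := by linarith
  have hR0 : 0 < R := by linarith
  set W : ℝ := (1 / P + 1 / Q + 1 / R) / (P * Q * R) with hW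
  have key : (I : ℝ) = x * ((Q - P) * (R - Q) * (R - P)) * W + (mp - x / P ^ 2) * (R - Q)
      - (mq - x / Q ^ 2) * (R - P) + (mr - x / R ^ 2) * (Q - P) := by
    rw [hIr, hW]; field_simp; ring
  have hW₁ : W ≤ 3 / D ^ 4 := by
    calc W ≤ (1 / D + 1 / D + 1 / D) / (D * D * D) := by rw [hW]; gcongr <;> linarith
      _ = 3 / D ^ 4 := by field_simp; ring
  have hW₂ : 3 / (16 * D ^ 4) ≤ W := by
    calc 3 / (16 * D ^ 4) = (1 / (2 * D) + 1 / (2 * D) + 1 / (2 * D)) / (2 * D * (2 * D) * (2 * D)) := by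
          field_simp; ring
      _ ≤ W := by rw [hW]; gcongr <;> linarith
  generalize (mp : ℝ) - x / P ^ 2 = α at *
  generalize (mq : ℝ) - x / Q ^ 2 = β at *
  generalize (mr : ℝ) - x / R ^ 2 = γ at *
  clear_value W
  have hsum : R - P = (Q - P) + (R - Q) := by ring
  have a1 : g ≤ Q - P := by linarith
  have a2 : g ≤ R - Q := by linarith
  generalize R - P = C at *
  generalize Q - P = A at *
  generalize R - Q = B at *
  have hA : 0 < A := by linarith
  have hB : 0 < B := by linarith
  have hC : 0 < C := by linarith
  have hV : A * B * C ≤ C ^ 3 / 4 := by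
    have h1 : A * B ≤ C ^ 2 / 4 := by rw [hsum]; linarith [sq_nonneg (A - B)]
    calc A * B * C ≤ C ^ 2 / 4 * C := by gcongr
      _ = C ^ 3 / 4 := by ring
  have hW0 : 0 ≤ W := le_trans (by positivity) hW₂
  have hpos : (0 : ℝ) < I := by
    have h1 : x * (g * g * C) * (3 / (16 * D ^ 4)) ≤ x * (A * B * C) * W := by gcongr
    have h2 : y / D ^ 2 < x * (g * g) * (3 / (16 * D ^ 4)) := by
      calc y / D ^ 2 = 16 * y * D ^ 2 * (1 / (16 * D ^ 4)) := by field_simp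
        _ < 3 * g ^ 2 * x * (1 / (16 * D ^ 4)) := by gcongr
        _ = x * (g * g) * (3 / (16 * D ^ 4)) := by ring
    have h3 : β * C ≤ y / D ^ 2 * C := by gcongr
    have h4 : y / D ^ 2 * C < x * (g * g) * (3 / (16 * D ^ 4)) * C := by gcongr
    have h5 : 0 ≤ α * B := by positivity
    have h6 : 0 ≤ γ * A := by positivity
    rw [key]; linarith
  have hlt : (I : ℝ) < 1 := by
    have h1 : x * (A * B * C) * W ≤ x * (C ^ 3 / 4) * (3 / D ^ 4) := by gcongr
    have h2 : x * (C ^ 3 / 4) * (3 / D ^ 4) ≤ 3 / 4 := by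
      rw [mul_div_assoc', div_le_div_iff₀ (by positivity) (by positivity)]
      linarith
    have h3 : α * B ≤ y / D ^ 2 * B := by gcongr
    have h4 : γ * A ≤ y / D ^ 2 * A := by gcongr
    have h5 : y / D ^ 2 * A + y / D ^ 2 * B < 1 / 4 := by
      rw [← mul_add, ← hsum, div_mul_eq_mul_div, div_lt_iff₀ (by positivity)]; linarith
    have h6 : 0 ≤ β * C := by positivity
    rw [key]; linarith
  have h1 : 0 < I := by exact_mod_cast hpos
  have h2 : I < 1 := by exact_mod_cast hlt
  omega

lemma not_four_close {x y D g : ℝ} {p q r s mp mq mr ms : ℤ} (hD : 0 < D) (hx : 0 < x)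
    (hy : 0 ≤ y) (hg : 0 < g) (hp : D ≤ p) (hs : (s : ℝ) ≤ 2 * D)
    (hpq : p + g ≤ q) (hqr : q + g ≤ r) (hrs : r + g ≤ s)
    (hp₁ : x ≤ mp * p ^ 2) (hp₂ : mp * p ^ 2 ≤ x + y)
    (hq₁ : x ≤ mq * q ^ 2) (hq₂ : mq * q ^ 2 ≤ x + y)
    (hr₁ : x ≤ mr * r ^ 2) (hr₂ : mr * r ^ 2 ≤ x + y)
    (hs₁ : x ≤ ms * s ^ 2) (hs₂ : ms * s ^ 2 ≤ x + y)
    (hDy : 16 * y * D ^ 3 < g ^ 3 * x) (ha : 8 * x * (s - p) ^ 6 ≤ D ^ 5)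
    (hay : 4 * y * (s - p) ^ 3 < D ^ 2) : False := by
  obtain ⟨α₀, α₁⟩ := sub_div_sq_mem (d := p) (m := mp) hD hy hp (by exact_mod_cast hp₁)
    (by exact_mod_cast hp₂)
  obtain ⟨β₀, β₁⟩ := sub_div_sq_mem (d := q) (m := mq) hD hy (by linarith) (by exact_mod_cast hq₁)
    (by exact_mod_cast hq₂)
  obtain ⟨γ₀, γ₁⟩ := sub_div_sq_mem (d := r) (m := mr) hD hy (by linarith) (by exact_mod_cast hr₁)
    (by exact_mod_cast hr₂)
  obtain ⟨ε₀, ε₁⟩ := sub_div_sq_mem (d := s) (m := ms) hD hy (by linarith) (by exact_mod_cast hs₁)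
    (by exact_mod_cast hs₂)
  set I : ℤ := mp * ((r - q) * (s - q) * (s - r)) - mq * ((r - p) * (s - p) * (s - r))
    + mr * ((q - p) * (s - p) * (s - q)) - ms * ((q - p) * (r - p) * (r - q)) with hI
  have hIr : (I : ℝ) = mp * ((r - q) * (s - q) * (s - r)) - mq * ((r - p) * (s - p) * (s - r))
    + mr * ((q - p) * (s - p) * (s - q)) - ms * ((q - p) * (r - p) * (r - q)) := by
    rw [hI]; push_cast; ring
  clear_value I
  generalize (p : ℝ) = P at *
  generalize (q : ℝ) = Q at *
  generalize (r : ℝ) = R at *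
  generalize (s : ℝ) = S at *
  have hP0 : 0 < P := by linarith
  have hQ0 : 0 < Q := by linarith
  have hR0 : 0 < R := by linarith
  have hS0 : 0 < S := by linarith
  set W : ℝ := (1 / P + 1 / Q + 1 / R + 1 / S) / (P * Q * R * S) with hW
  have key : (I : ℝ) = x * ((Q - P) * (R - P) * (S - P) * (R - Q) * (S - Q) * (S - R)) * W
      + (mp - x / P ^ 2) * ((R - Q) * (S - Q) * (S - R))
      - (mq - x / Q ^ 2) * ((R - P) * (S - P) * (S - R))
      + (mr - x / R ^ 2) * ((Q - P) * (S - P) * (S - Q))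
      - (ms - x / S ^ 2) * ((Q - P) * (R - P) * (R - Q)) := by
    rw [hIr, hW]; field_simp; ring
  have hW₁ : W ≤ 4 / D ^ 5 := by
    calc W ≤ (1 / D + 1 / D + 1 / D + 1 / D) / (D * D * D * D) := by rw [hW]; gcongr <;> linarith
      _ = 4 / D ^ 5 := by field_simp; ring
  have hW₂ : 1 / (8 * D ^ 5) ≤ W := by
    calc 1 / (8 * D ^ 5) = (1 / (2 * D) + 1 / (2 * D) + 1 / (2 * D) + 1 / (2 * D)) /
          (2 * D * (2 * D) * (2 * D) * (2 * D)) := by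
          field_simp; ring
      _ ≤ W := by rw [hW]; gcongr <;> linarith
  generalize (mp : ℝ) - x / P ^ 2 = α at *
  generalize (mq : ℝ) - x / Q ^ 2 = β at *
  generalize (mr : ℝ) - x / R ^ 2 = γ at *
  generalize (ms : ℝ) - x / S ^ 2 = ε at *
  clear_value W
  have a1 : g ≤ Q - P := by linarith
  have a2 : g ≤ R - P := by linarith
  have a3 : g ≤ S - P := by linarith
  have a4 : g ≤ R - Q := by linarith
  have a5 : g ≤ S - Q := by linarith
  have a6 : g ≤ S - R := by linarith
  have b1 : Q - P ≤ S - P := by linarith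
  have b2 : R - P ≤ S - P := by linarith
  have b4 : R - Q ≤ S - P := by linarith
  have b5 : S - Q ≤ S - P := by linarith
  have b6 : S - R ≤ S - P := by linarith
  generalize Q - P = A at *
  generalize R - P = B at *
  generalize S - P = C at *
  generalize R - Q = E at *
  generalize S - Q = F at *
  generalize S - R = G at *
  have hA : 0 < A := by linarith
  have hB : 0 < B := by linarith
  have hC : 0 < C := by linarith
  have hE : 0 < E := by linarith
  have hF : 0 < F := by linarith
  have hG : 0 < G := by linarith
  have hW0 : 0 ≤ W := le_trans (by positivity) hW₂
  have hpos : (0 : ℝ) < I := by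
    set V := A * B * C * E * F * G with hV
    have hV0 : 0 < V := by positivity
    have h1 : x * V * (1 / (8 * D ^ 5)) ≤ x * V * W := by gcongr
    have h2 : β * (B * C * G) * g ^ 3 ≤ y / D ^ 2 * V := by
      calc β * (B * C * G) * g ^ 3 = β * (B * C * G) * (g * g * g) := by ring
        _ ≤ y / D ^ 2 * (B * C * G) * (A * E * F) := by gcongr
        _ = y / D ^ 2 * V := by rw [hV]; ring
    have h3 : ε * (A * B * E) * g ^ 3 ≤ y / D ^ 2 * V := by
      calc ε * (A * B * E) * g ^ 3 = ε * (A * B * E) * (g * g * g) := by ring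
        _ ≤ y / D ^ 2 * (A * B * E) * (C * F * G) := by gcongr
        _ = y / D ^ 2 * V := by rw [hV]; ring
    have h4 : 2 * (y / D ^ 2) < x * (1 / (8 * D ^ 5)) * g ^ 3 := by
      rw [show 2 * (y / D ^ 2) = 16 * y * D ^ 3 * (1 / (8 * D ^ 5)) by field_simp; ring]
      calc _ < g ^ 3 * x * (1 / (8 * D ^ 5)) := by gcongr
        _ = _ := by ring
    have h5 : 2 * (y / D ^ 2) * V < x * (1 / (8 * D ^ 5)) * g ^ 3 * V := by gcongr
    have h6 : β * (B * C * G) + ε * (A * B * E) < x * V * (1 / (8 * D ^ 5)) := by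
      refine lt_of_mul_lt_mul_right (a := g ^ 3) ?_ (by positivity)
      linarith
    have h7 : 0 ≤ α * (E * F * G) := by positivity
    have h8 : 0 ≤ γ * (A * C * F) := by positivity
    rw [key]; linarith
  have hlt : (I : ℝ) < 1 := by
    have h1 : x * (A * B * C * E * F * G) * W ≤ x * (C * C * C * C * C * C) * (4 / D ^ 5) := by
      gcongr
    have h2 : x * (C * C * C * C * C * C) * (4 / D ^ 5) ≤ 1 / 2 := by
      rw [mul_div_assoc', div_le_div_iff₀ (by positivity) (by positivity)]
      linarith
    have h3 : α * (E * F * G) ≤ y / D ^ 2 * (C * C * C) := by gcongr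
    have h4 : γ * (A * C * F) ≤ y / D ^ 2 * (C * C * C) := by gcongr
    have h5 : y / D ^ 2 * (C * C * C) < 1 / 4 := by
      rw [div_mul_eq_mul_div, div_lt_iff₀ (by positivity)]; linarith
    have h6 : 0 ≤ β * (B * C * G) := by positivity
    have h7 : 0 ≤ ε * (A * B * E) := by positivity
    rw [key]; linarith
  have h1 : 0 < I := by exact_mod_cast hpos
  have h2 : I < 1 := by exact_mod_cast hlt
  omega

/-- If every increasing sequence of `K + 1` elements of a subset of `[D, 2 * D)` has span at least
`w`, then the subset has few elements. -/
lemma card_le_of_span {S : Finset ℕ} {D w : ℝ} {K : ℕ} (hw : 0 < w)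
    (hS : ∀ d ∈ S, D ≤ d ∧ (d : ℝ) < 2 * D)
    (h : ∀ f : ℕ → ℕ, (∀ i ≤ K, f i ∈ S) → (∀ i j, i < j → j ≤ K → f i < f j) →
      w ≤ (f K : ℝ) - f 0) :
    S.card ≤ K * (⌊D / w⌋₊ + 1) := by
  by_contra! hlt
  obtain ⟨b, -, hb⟩ := Finset.exists_lt_card_fiber_of_mul_lt_card_of_maps_to
    (s := S) (t := Finset.range (⌊D / w⌋₊ + 1)) (f := fun d => ⌊((d : ℝ) - D) / w⌋₊) (n := K)
    (fun d hd => by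
      have := hS d hd
      simp only [Finset.mem_range, Nat.lt_succ_iff]
      exact Nat.floor_mono (by gcongr; linarith))
    (by rw [Finset.card_range, mul_comm]; exact hlt)
  set T := S.filter (fun d : ℕ => ⌊((d : ℝ) - D) / w⌋₊ = b) with hT
  have hdiff : ∀ d ∈ T, ∀ d' ∈ T, (d' : ℝ) - d < w := by
    intro d hd d' hd'
    simp only [hT, Finset.mem_filter] at hd hd'
    have h1 : (b : ℝ) ≤ ((d : ℝ) - D) / w := by
      rw [← hd.2]
      exact Nat.floor_le (div_nonneg (by linarith [(hS d hd.1).1]) hw.le)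
    have h2 : ((d' : ℝ) - D) / w < b + 1 := by
      rw [← hd'.2]
      exact Nat.lt_floor_add_one _
    rw [le_div_iff₀ hw] at h1
    rw [div_lt_iff₀ hw] at h2
    linarith
  set e := T.orderEmbOfFin rfl
  have he : ∀ i, e i ∈ T := T.orderEmbOfFin_mem rfl
  set f : ℕ → ℕ := fun i => if hi : i < T.card then e ⟨i, hi⟩ else 0 with hf
  have hfT : ∀ i ≤ K, f i ∈ T := by
    intro i hi
    have : i < T.card := by omega
    simp only [hf, this, dif_pos]
    exact he _
  have := h f (fun i hi => (Finset.mem_filter.1 (hfT i hi)).1) (by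
    intro i j hij hj
    have h1 : i < T.card := by omega
    have h2 : j < T.card := by omega
    simp only [hf, h1, h2, dif_pos]
    exact e.strictMono hij)
  linarith [hdiff _ (hfT 0 (Nat.zero_le _)) _ (hfT K le_rfl)]

lemma add_le_of_increasing {f : ℕ → ℕ} {K : ℕ} (h : ∀ i j, i < j → j ≤ K → f i < f j) (i k : ℕ)
    (hik : i + k ≤ K) : f i + k ≤ f (i + k) := by
  induction k with
  | zero => simp
  | succ k ih =>
    have := h (i + k) (i + (k + 1)) (by omega) hik
    have := ih (by omega)
    omega

lemma card_le_of_mem_Icc {T : Finset ℤ} {u v : ℝ} (hv : 0 ≤ v)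
    (hT : ∀ n ∈ T, u ≤ n ∧ (n : ℝ) ≤ u + v) : (T.card : ℝ) ≤ v + 1 := by
  have h : T ⊆ Finset.Icc ⌈u⌉ ⌊u + v⌋ := fun n hn => by
    rw [Finset.mem_Icc, Int.ceil_le, Int.le_floor]
    exact hT n hn
  have h1 := Finset.card_le_card h
  rw [Int.card_Icc] at h1
  have h2 : ((⌊u + v⌋ + 1 - ⌈u⌉).toNat : ℝ) ≤ v + 1 := by
    rw [← Int.cast_natCast, Int.toNat_eq_max]
    push_cast
    refine max_le ?_ (by linarith)
    linarith [Int.floor_le (u + v), Int.le_ceil u]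
  exact (Nat.cast_le.2 h1).trans h2

lemma card_multiples_le {T : Finset ℕ} {x y : ℝ} {q : ℕ} (hq : 0 < q) (hy : 0 ≤ y)
    (hT : ∀ n ∈ T, q ∣ n ∧ x ≤ n ∧ (n : ℝ) ≤ x + y) : (T.card : ℝ) ≤ y / q + 1 := by
  have hq' : (0 : ℝ) < q := by exact_mod_cast hq
  have hinj : Set.InjOn (fun n : ℕ => ((n / q : ℕ) : ℤ)) T := by
    intro a ha b hb hab
    have : a / q = b / q := Nat.cast_injective hab
    rw [← Nat.div_mul_cancel (hT a ha).1, ← Nat.div_mul_cancel (hT b hb).1, this]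
  rw [← Finset.card_image_of_injOn hinj]
  refine card_le_of_mem_Icc (u := x / q) (by positivity) ?_
  intro k hk
  obtain ⟨n, hn, rfl⟩ := Finset.mem_image.1 hk
  obtain ⟨⟨c, rfl⟩, h1, h2⟩ := hT n hn
  rw [Nat.mul_div_cancel_left _ hq, ← add_div, div_le_iff₀ hq', le_div_iff₀ hq']
  push_cast at h1 h2 ⊢
  constructor <;> linarith

/-- Bound for the number of `d` in a dyadic interval such that `d ^ 2` has a multiple in
`[x, x + y]`. -/
lemma card_dyadic_le {S : Finset ℕ} {t x y D : ℝ} (ht : 1 ≤ t) (hx : x = t ^ 9) (hy : 1 ≤ y)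
    (hyt : y ≤ t ^ 3) (hyx : 65536 * y ≤ x) (hyD : y < 32 * D) (hDx : D ^ 2 * y ≤ 32 * x)
    (hS : ∀ d ∈ S, D ≤ d ∧ (d : ℝ) < 2 * D)
    (hS' : ∀ d ∈ S, ∃ m : ℕ, x ≤ m * (d : ℝ) ^ 2 ∧ m * (d : ℝ) ^ 2 ≤ x + y) :
    (S.card : ℝ) ≤ 2880 * t ^ 2 := by
  have ht0 : 0 < t := by linarith
  have hx0 : 0 < x := by rw [hx]; positivity
  have hD : 0 < D := by linarith
  choose! m hm using hS'
  have hthree : ∀ p ∈ S, ∀ q ∈ S, ∀ r ∈ S, p + 16 ≤ q → q + 16 ≤ r →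
      D ^ 4 < x * ((r : ℝ) - p) ^ 3 := by
    intro p hp q hq r hr hpq hqr
    by_contra! hle
    have hpq' : (p : ℝ) + 16 ≤ q := by exact_mod_cast hpq
    have hqr' : (q : ℝ) + 16 ≤ r := by exact_mod_cast hqr
    refine not_three_close (p := p) (q := q) (r := r) (mp := m p) (mq := m q) (mr := m r) (g := 16)
      (y := y) hD hx0 (by linarith)
      (by norm_num) (by exact_mod_cast (hS p hp).1) (by push_cast; exact (hS r hr).2.le)
      (by exact_mod_cast hpq) (by exact_mod_cast hqr)
      (by exact_mod_cast (hm p hp).1) (by exact_mod_cast (hm p hp).2)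
      (by exact_mod_cast (hm q hq).1) (by exact_mod_cast (hm q hq).2)
      (by exact_mod_cast (hm r hr).1) (by exact_mod_cast (hm r hr).2)
      (by nlinarith) (by push_cast; exact hle) ?_
    push_cast
    refine lt_of_pow_lt_pow_left₀ 3 (by positivity) ?_
    refine lt_of_mul_lt_mul_left (a := x) ?_ hx0.le
    have hy2 : y ^ 2 < 1024 * D ^ 2 := by nlinarith
    have h64 : 64 * y ^ 3 < x * D ^ 2 := by nlinarith
    calc x * (((r : ℝ) - p) * y) ^ 3 = x * ((r : ℝ) - p) ^ 3 * y ^ 3 := by ring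
      _ ≤ D ^ 4 * y ^ 3 := by gcongr
      _ < D ^ 4 * (x * D ^ 2 / 64) := by gcongr; linarith
      _ = x * (D ^ 2 / 4) ^ 3 := by ring
  have hw : 0 < D / (2 * t ^ 2) := by positivity
  have hcard : S.card ≤ 960 * (⌊D / (D / (2 * t ^ 2))⌋₊ + 1) := by
    refine card_le_of_span hw hS fun f hfS hf => ?_
    by_contra! hlt
    have hgap := add_le_of_increasing hf
    rcases le_or_gt D (t ^ 3) with hDt | hDt
    · obtain ⟨s, hs0, hs⟩ : ∃ s : ℝ, 0 < s ∧ s ^ 3 = D ^ 4 / x := by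
        refine ⟨(D ^ 4 / x) ^ ((1 : ℝ) / 3), by positivity, ?_⟩
        rw [← Real.rpow_natCast, ← Real.rpow_mul (by positivity)]
        norm_num
      have hstep : ∀ i, i + 32 ≤ 960 → (f i : ℝ) + s ≤ f (i + 32) := by
        intro i hi
        have h1 := hthree (f i) (hfS _ (by omega)) (f (i + 16)) (hfS _ (by omega)) (f (i + 32))
          (hfS _ (by omega)) (hgap i 16 (by omega)) (hgap (i + 16) 16 (by omega))
        have h2 : s ^ 3 < ((f (i + 32) : ℝ) - f i) ^ 3 := by
          rw [hs, div_lt_iff₀ hx0]; linarith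
        have h3 : (f i : ℝ) ≤ f (i + 32) := by
          exact_mod_cast (Nat.le_add_right _ _).trans (hgap i 32 hi)
        have := lt_of_pow_lt_pow_left₀ 3 (by linarith) h2
        linarith
      have hstep' : ∀ k i, i + 32 * k ≤ 960 → (f i : ℝ) + k * s ≤ f (i + 32 * k) := by
        intro k i hi
        induction k with
        | zero => simp
        | succ k ih =>
          have h1 := ih (by omega)
          have h2 := hstep (i + 32 * k) (by omega)
          rw [show i + 32 * (k + 1) = i + 32 * k + 32 by ring]
          push_cast
          linarith
      have g1 := hstep' 10 0 (by norm_num)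
      have g2 := hstep' 10 320 (by norm_num)
      have g3 := hstep' 10 640 (by norm_num)
      norm_num at g1 g2 g3
      have m0 := hfS 0 (by norm_num)
      have m1 := hfS 320 (by norm_num)
      have m2 := hfS 640 (by norm_num)
      have m3 := hfS 960 (by norm_num)
      have hnn : (0 : ℝ) ≤ (f 960 : ℝ) - f 0 := by linarith
      refine not_four_close (x := x) (y := y) (D := D) (g := 10 * s) (p := f 0) (q := f 320)
        (r := f 640) (s := f 960) (mp := m (f 0)) (mq := m (f 320)) (mr := m (f 640))
        (ms := m (f 960)) hD hx0 (by linarith) (by positivity)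
        (by exact_mod_cast (hS _ m0).1) (by push_cast; exact (hS _ m3).2.le)
        (by push_cast; linarith) (by push_cast; linarith) (by push_cast; linarith)
        (by exact_mod_cast (hm _ m0).1) (by exact_mod_cast (hm _ m0).2)
        (by exact_mod_cast (hm _ m1).1) (by exact_mod_cast (hm _ m1).2)
        (by exact_mod_cast (hm _ m2).1) (by exact_mod_cast (hm _ m2).2)
        (by exact_mod_cast (hm _ m3).1) (by exact_mod_cast (hm _ m3).2) ?_ ?_ ?_
      · rw [mul_pow, hs]
        rw [show (10 : ℝ) ^ 3 * (D ^ 4 / x) * x = 1000 * D * D ^ 3 by field_simp; norm_num]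
        exact mul_lt_mul_of_pos_right (by linarith) (by positivity)
      · push_cast
        calc 8 * x * ((f 960 : ℝ) - f 0) ^ 6 ≤ 8 * x * (D / (2 * t ^ 2)) ^ 6 := by gcongr
          _ = D ^ 5 * (D / (8 * t ^ 3)) := by rw [hx]; field_simp; norm_num
          _ ≤ D ^ 5 * 1 := by
            gcongr
            rw [div_le_one (by positivity)]
            linarith
          _ = D ^ 5 := mul_one _
      · push_cast
        calc 4 * y * ((f 960 : ℝ) - f 0) ^ 3 ≤ 4 * t ^ 3 * (D / (2 * t ^ 2)) ^ 3 := by gcongr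
          _ = D ^ 2 * (D / (2 * t ^ 3)) := by field_simp; norm_num
          _ < D ^ 2 * 1 := by
            gcongr
            rw [div_lt_one (by positivity)]
            linarith [pow_pos ht0 3]
          _ = D ^ 2 := mul_one _
    · have h1 := hthree (f 0) (hfS _ (by omega)) (f 16) (hfS _ (by omega)) (f 960)
          (hfS _ (by omega)) (hgap 0 16 (by omega))
          ((Nat.add_le_add_left (by norm_num) _).trans (hgap 16 944 (by omega)))
      have hnn : (0 : ℝ) ≤ (f 960 : ℝ) - f 0 := by
        have := hgap 0 960 (by norm_num)
        have : f 0 ≤ f 960 := by simpa using (Nat.le_add_right _ _).trans this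
        have : (f 0 : ℝ) ≤ f 960 := by exact_mod_cast this
        linarith
      have h2 : x * ((f 960 : ℝ) - f 0) ^ 3 ≤ D ^ 4 := by
        calc x * ((f 960 : ℝ) - f 0) ^ 3 ≤ x * (D / (2 * t ^ 2)) ^ 3 := by gcongr
          _ = D ^ 3 * (t ^ 3 / 8) := by rw [hx]; field_simp; norm_num
          _ ≤ D ^ 3 * D := by gcongr; linarith [pow_pos ht0 3]
          _ = D ^ 4 := by ring
      linarith
  have hfl : (⌊D / (D / (2 * t ^ 2))⌋₊ : ℝ) ≤ 2 * t ^ 2 := by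
    refine (Nat.floor_le (by positivity)).trans (le_of_eq ?_)
    field_simp
  calc (S.card : ℝ) ≤ 960 * ((⌊D / (D / (2 * t ^ 2))⌋₊ : ℝ) + 1) := by exact_mod_cast hcard
    _ ≤ 960 * (2 * t ^ 2 + t ^ 2) := by gcongr; nlinarith
    _ = 2880 * t ^ 2 := by ring

lemma sum_inv_sq_le (n : ℕ) : ∑ d ∈ Finset.Icc 2 n, 1 / (d : ℝ) ^ 2 ≤ 3 / 4 := by
  rcases lt_or_ge n 2 with hn | hn
  · rw [Finset.Icc_eq_empty (by omega), Finset.sum_empty]; norm_num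
  suffices h : ∑ d ∈ Finset.Icc 2 n, 1 / (d : ℝ) ^ 2 ≤ 3 / 4 - 1 / (n : ℝ) from
    h.trans (sub_le_self _ (by positivity))
  induction n, hn using Nat.le_induction with
  | base => norm_num
  | succ n hn ih =>
    rw [Finset.sum_Icc_succ_top (by omega)]
    have hn0 : (0 : ℝ) < n := by exact_mod_cast (by omega : 0 < n)
    have : 1 / ((n + 1 : ℕ) : ℝ) ^ 2 ≤ 1 / n - 1 / (n + 1 : ℕ) := by
      push_cast
      rw [div_sub_div _ _ (by positivity) (by positivity),
        div_le_div_iff₀ (by positivity) (by positivity)]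
      nlinarith
    linarith

lemma le_of_mul_sq_close {x y : ℝ} {m d d' : ℕ} (hxy : y ^ 2 < 4 * x)
    (hd : x ≤ m * (d : ℝ) ^ 2) (hd' : m * (d' : ℝ) ^ 2 ≤ x + y) : d' ≤ d := by
  by_contra! hlt
  have h1 : (d : ℝ) + 1 ≤ d' := by exact_mod_cast hlt
  have hm : 1 ≤ m := by
    rcases Nat.eq_zero_or_pos m with rfl | h
    · have : x ≤ 0 := by simpa using hd
      nlinarith
    · exact h
  have hm' : (1 : ℝ) ≤ m := by exact_mod_cast hm
  have hd0 : (0 : ℝ) ≤ d := by positivity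
  have h2 : (m : ℝ) * (d + 1) ^ 2 ≤ m * (d' : ℝ) ^ 2 := by gcongr
  have h3 : 2 * (m * (d : ℝ)) ≤ y := by nlinarith
  have h4 : (2 * (m * (d : ℝ))) ^ 2 ≤ y ^ 2 := by gcongr
  have h5 : (m : ℝ) * (d : ℝ) ^ 2 ≤ m * (m * (d : ℝ) ^ 2) :=
    le_mul_of_one_le_left (by positivity) hm'
  nlinarith

lemma exists_squarefree_of_bounds {t x y : ℝ} (ht : 1 ≤ t) (hx : x = t ^ 9) (hy : 1024 ≤ y)
    (hyt : y ≤ t ^ 3) (hyx : 65536 * y ≤ x)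
    (hlog : (Nat.log 2 ⌊x⌋₊ + 1) * (2880 * t ^ 2) ≤ y / 32) :
    ∃ n : ℕ, 1 ≤ n ∧ x ≤ n ∧ (n : ℝ) ≤ x + y ∧ Squarefree n := by
  classical
  by_contra! hcon
  have hy0 : 0 ≤ y := by linarith
  have hx0 : 0 < x := by linarith
  have hy2 : y ^ 2 < 4 * x := by
    calc y ^ 2 ≤ (t ^ 3) ^ 2 := by gcongr
      _ = t ^ 6 := by ring
      _ ≤ t ^ 9 := pow_le_pow_right₀ ht (by norm_num)
      _ < 4 * x := by linarith
  set N : Finset ℕ := Finset.Icc ⌈x⌉₊ ⌊x + y⌋₊ with hN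
  have memN : ∀ n, n ∈ N ↔ x ≤ n ∧ (n : ℝ) ≤ x + y := fun n => by
    rw [hN, Finset.mem_Icc, Nat.ceil_le, Nat.le_floor_iff (by linarith)]
  have hNcard : y - 1 ≤ N.card := by
    rw [hN, Nat.card_Icc]
    have h1 := Nat.lt_floor_add_one (x + y)
    have h2 := Nat.ceil_lt_add_one hx0.le
    have h3 : ((⌊x + y⌋₊ + 1 : ℕ) : ℝ) ≤ ((⌊x + y⌋₊ + 1 - ⌈x⌉₊ : ℕ) : ℝ) + ⌈x⌉₊ := by
      exact_mod_cast le_tsub_add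
    push_cast at h3
    linarith
  have hmult : ∀ d : ℕ, 0 < d → ((N.filter (d ^ 2 ∣ ·)).card : ℝ) ≤ y / (d : ℝ) ^ 2 + 1 := by
    intro d hd
    have := card_multiples_le (T := N.filter (d ^ 2 ∣ ·)) (x := x) (y := y) (q := d ^ 2)
      (by positivity) hy0 (fun n hn => by
        rw [Finset.mem_filter, memN] at hn
        exact ⟨hn.2, hn.1⟩)
    exact_mod_cast this
  -- integers divisible by the square of a small number
  set A := (Finset.Icc 2 ⌊y / 16⌋₊).biUnion (fun d => N.filter (d ^ 2 ∣ ·)) with hA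
  have hAcard : (A.card : ℝ) ≤ 3 / 4 * y + y / 16 := by
    calc (A.card : ℝ) ≤ ∑ d ∈ Finset.Icc 2 ⌊y / 16⌋₊, ((N.filter (d ^ 2 ∣ ·)).card : ℝ) := by
          exact_mod_cast Finset.card_biUnion_le
      _ ≤ ∑ d ∈ Finset.Icc 2 ⌊y / 16⌋₊, (y * (1 / (d : ℝ) ^ 2) + 1) := by
          refine Finset.sum_le_sum fun d hd => ?_
          rw [Finset.mem_Icc] at hd
          rw [mul_one_div]
          exact hmult d (by omega)
      _ = y * ∑ d ∈ Finset.Icc 2 ⌊y / 16⌋₊, 1 / (d : ℝ) ^ 2 + ((⌊y / 16⌋₊ + 1 - 2 : ℕ) : ℝ) := by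
          rw [Finset.sum_add_distrib, Finset.mul_sum, Finset.sum_const, Nat.card_Icc, nsmul_one]
      _ ≤ y * (3 / 4) + y / 16 := by
          gcongr
          · exact sum_inv_sq_le _
          · refine le_trans ?_ (Nat.floor_le (by positivity : 0 ≤ y / 16))
            exact_mod_cast (by omega : ⌊y / 16⌋₊ + 1 - 2 ≤ ⌊y / 16⌋₊)
      _ = _ := by ring
  -- integers divisible by the square of a number of intermediate size
  set S : ℕ → Finset ℕ := fun j => (Finset.range (⌊x⌋₊ + 1)).filter (fun d =>
    Nat.log 2 d = j ∧ y < 16 * d ∧ (d : ℝ) ^ 2 * y ≤ 32 * x ∧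
      ∃ m : ℕ, x ≤ m * (d : ℝ) ^ 2 ∧ m * (d : ℝ) ^ 2 ≤ x + y) with hS
  have hScard : ∀ j, ((S j).card : ℝ) ≤ 2880 * t ^ 2 := by
    intro j
    rcases (S j).eq_empty_or_nonempty with he | ⟨d₀, hd₀⟩
    · rw [he, Finset.card_empty, Nat.cast_zero]; positivity
    have hdy : ∀ d ∈ S j, ((2 ^ j : ℝ)) ≤ d ∧ (d : ℝ) < 2 * 2 ^ j := by
      intro d hd
      obtain ⟨-, hj, h1, -⟩ := Finset.mem_filter.1 hd
      have hd0 : d ≠ 0 := by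
        rintro rfl
        norm_num at h1
        linarith
      have h2 := Nat.pow_log_le_self 2 hd0
      have h3 := Nat.lt_pow_succ_log_self (b := 2) (by norm_num) d
      rw [hj] at h2 h3
      rw [pow_succ, mul_comm] at h3
      exact ⟨by exact_mod_cast h2, by exact_mod_cast h3⟩
    obtain ⟨-, -, h1, h2, -⟩ := Finset.mem_filter.1 hd₀
    obtain ⟨h3, h4⟩ := hdy d₀ hd₀
    refine card_dyadic_le (x := x) (y := y) (D := 2 ^ j) ht hx (by linarith) hyt hyx (by linarith)
      ?_ hdy (fun d hd => (Finset.mem_filter.1 hd).2.2.2.2)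
    refine le_trans ?_ h2
    gcongr
  set B := (Finset.range (Nat.log 2 ⌊x⌋₊ + 1)).biUnion
    (fun j => (S j).biUnion (fun d => N.filter (d ^ 2 ∣ ·))) with hB
  have hBcard : (B.card : ℝ) ≤ y / 32 := by
    have hj : ∀ j, (((S j).biUnion (fun d => N.filter (d ^ 2 ∣ ·))).card : ℝ) ≤ 2880 * t ^ 2 := by
      intro j
      refine le_trans ?_ (hScard j)
      rw [← mul_one (S j).card]
      refine Nat.cast_le.2 (Finset.card_biUnion_le_card_mul _ _ _ fun d hd => ?_)
      obtain ⟨-, -, h1, -⟩ := Finset.mem_filter.1 hd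
      have hd0 : (0 : ℝ) < d := by linarith
      have h2 := hmult d (by exact_mod_cast hd0)
      have h3 : y / (d : ℝ) ^ 2 < 1 := by
        rw [div_lt_one (by positivity)]
        nlinarith
      have h4 : ((N.filter (d ^ 2 ∣ ·)).card : ℝ) < 2 := by linarith
      have : (N.filter (d ^ 2 ∣ ·)).card < 2 := by exact_mod_cast h4
      omega
    calc (B.card : ℝ) ≤ ∑ j ∈ Finset.range (Nat.log 2 ⌊x⌋₊ + 1),
          (((S j).biUnion (fun d => N.filter (d ^ 2 ∣ ·))).card : ℝ) := by
          exact_mod_cast Finset.card_biUnion_le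
      _ ≤ ∑ j ∈ Finset.range (Nat.log 2 ⌊x⌋₊ + 1), 2880 * t ^ 2 := Finset.sum_le_sum fun j _ => hj j
      _ = (Nat.log 2 ⌊x⌋₊ + 1) * (2880 * t ^ 2) := by
          rw [Finset.sum_const, Finset.card_range, nsmul_eq_mul]; push_cast; ring
      _ ≤ y / 32 := hlog
  -- integers divisible by the square of a large number
  set C := (Finset.Icc 1 ⌊y / 16⌋₊).biUnion
    (fun m => N.filter (fun n => ∃ d : ℕ, n = m * d ^ 2)) with hC
  have hCcard : (C.card : ℝ) ≤ y / 16 := by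
    have h1 : C.card ≤ (Finset.Icc 1 ⌊y / 16⌋₊).card * 1 := by
      refine Finset.card_biUnion_le_card_mul _ _ _ fun m _ => Finset.card_le_one.2 ?_
      intro a ha b hb
      rw [Finset.mem_filter, memN] at ha hb
      obtain ⟨⟨ha1, ha2⟩, d, rfl⟩ := ha
      obtain ⟨⟨hb1, hb2⟩, d', rfl⟩ := hb
      push_cast at ha1 ha2 hb1 hb2
      rw [le_antisymm (le_of_mul_sq_close hy2 hb1 ha2) (le_of_mul_sq_close hy2 ha1 hb2)]
    rw [Nat.card_Icc, mul_one, Nat.add_sub_cancel] at h1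
    exact (Nat.cast_le.2 h1).trans (Nat.floor_le (by positivity))
  have hcover : N ⊆ A ∪ B ∪ C := by
    intro n hn
    obtain ⟨hn1, hn2⟩ := (memN n).1 hn
    have hn0 : 1 ≤ n := by
      have : (0 : ℝ) < n := by linarith
      exact_mod_cast this
    have hsq := hcon n hn0 hn1 hn2
    rw [Nat.squarefree_iff_prime_squarefree] at hsq
    push Not at hsq
    obtain ⟨p, hp, hpn⟩ := hsq
    rw [← pow_two] at hpn
    simp only [Finset.mem_union]
    rcases le_or_gt (p : ℝ) (y / 16) with h1 | h1
    · left; left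
      rw [hA, Finset.mem_biUnion]
      exact ⟨p, Finset.mem_Icc.2 ⟨hp.two_le, Nat.le_floor h1⟩, Finset.mem_filter.2 ⟨hn, hpn⟩⟩
    obtain ⟨m, rfl⟩ := hpn
    push_cast at hn1 hn2
    have hp0 : (0 : ℝ) < p := by exact_mod_cast hp.pos
    rcases le_or_gt ((p : ℝ) ^ 2 * y) (32 * x) with h2 | h2
    · left; right
      have hpx : p ≤ ⌊x⌋₊ := by
        refine Nat.le_floor ?_
        nlinarith
      rw [hB, Finset.mem_biUnion]
      refine ⟨Nat.log 2 p, Finset.mem_range.2 (Nat.lt_succ_of_le (Nat.log_mono_right hpx)), ?_⟩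
      rw [Finset.mem_biUnion]
      refine ⟨p, Finset.mem_filter.2 ⟨Finset.mem_range.2 (Nat.lt_succ_of_le hpx), rfl, by linarith,
        h2, m, by linarith, by linarith⟩, Finset.mem_filter.2 ⟨hn, dvd_mul_right _ _⟩⟩
    · right
      rw [hC, Finset.mem_biUnion]
      refine ⟨m, Finset.mem_Icc.2 ⟨?_, Nat.le_floor ?_⟩, Finset.mem_filter.2 ⟨hn, p, mul_comm _ _⟩⟩
      · by_contra! hm
        rw [Nat.lt_one_iff.1 hm, mul_zero] at hn0
        omega
      · refine le_of_mul_le_mul_left (a := 32 * x) ?_ (by positivity)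
        calc 32 * x * (m : ℝ) ≤ (p : ℝ) ^ 2 * y * m := by gcongr
          _ = (p : ℝ) ^ 2 * m * y := by ring
          _ ≤ (2 * x) * y := mul_le_mul_of_nonneg_right (by linarith) hy0
          _ = 32 * x * (y / 16) := by ring
  have h1 : (N.card : ℝ) ≤ A.card + B.card + C.card := by
    have h2 := Finset.card_le_card hcover
    have h3 := Finset.card_union_le (A ∪ B) C
    have h4 := Finset.card_union_le A B
    exact_mod_cast (by omega : N.card ≤ A.card + B.card + C.card)
  linarith

lemma natLog_two_floor_le {x : ℝ} (hx : 1 ≤ Real.log x) (hx0 : 1 ≤ x) :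
    (Nat.log 2 ⌊x⌋₊ + 1 : ℝ) ≤ 3 * Real.log x := by
  have h0 : ⌊x⌋₊ ≠ 0 := (Nat.floor_pos.2 hx0).ne'
  have h1 : (2 : ℝ) ^ Nat.log 2 ⌊x⌋₊ ≤ x := by
    refine le_trans ?_ (Nat.floor_le (by linarith))
    exact_mod_cast Nat.pow_log_le_self 2 h0
  have h2 := Real.log_le_log (by positivity) h1
  rw [Real.log_pow] at h2
  have h3 := Real.log_two_gt_d9
  have h4 : (0 : ℝ) ≤ Nat.log 2 ⌊x⌋₊ := by positivity
  nlinarith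

theorem stmt_19 :
    ∃ c₀ : ℝ, 0 < c₀ ∧
      ∃ x₀ : ℝ, ∀ x : ℝ, x₀ ≤ x →
        ∀ y : ℝ, c₀ * x ^ ((2:ℝ)/9) * Real.log x ≤ y → y < (1/4) * Real.sqrt x →
          ∃ n : ℤ, 1 ≤ n ∧ x ≤ (n:ℝ) ∧ (n:ℝ) ≤ x + y ∧ Squarefree n := by
  refine ⟨276480, by norm_num, ?_⟩
  have hlog := (isLittleO_log_rpow_atTop (r := (1 : ℝ) / 9) (by norm_num)).bound
    (c := 1 / 276480) (by norm_num)
  have ht := (tendsto_rpow_atTop (y := (1 : ℝ) / 9) (by norm_num)).eventually_ge_atTop 65536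
  obtain ⟨x₀, hx₀⟩ := Filter.eventually_atTop.1 (hlog.and (ht.and
    ((Real.tendsto_log_atTop.eventually_ge_atTop 1).and (Filter.eventually_ge_atTop 1))))
  refine ⟨x₀, fun x hx y hy _ => ?_⟩
  obtain ⟨h1, h2, h3, h4⟩ := hx₀ x hx
  have hx0 : 0 < x := by linarith
  set t : ℝ := x ^ ((1 : ℝ) / 9) with ht
  have ht0 : 0 < t := by linarith
  have hxt : x = t ^ 9 := by
    rw [ht, ← Real.rpow_natCast, ← Real.rpow_mul hx0.le]; norm_num
  have hx2 : x ^ ((2 : ℝ) / 9) = t ^ 2 := by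
    rw [ht, ← Real.rpow_natCast, ← Real.rpow_mul hx0.le]; norm_num
  rw [Real.norm_of_nonneg (by linarith), Real.norm_of_nonneg ht0.le] at h1
  rw [hx2] at hy
  have hyt : 276480 * t ^ 2 * Real.log x ≤ t ^ 3 := by
    calc 276480 * t ^ 2 * Real.log x ≤ 276480 * t ^ 2 * (1 / 276480 * t) := by gcongr
      _ = t ^ 3 := by ring
  have ht1 : 1 ≤ t ^ 2 := one_le_pow₀ (by linarith)
  obtain ⟨n, hn1, hn2, hn3, hn4⟩ := exists_squarefree_of_bounds (t := t) (x := x)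
    (y := 276480 * t ^ 2 * Real.log x) (by linarith) hxt (by nlinarith) hyt
    (by
      calc 65536 * (276480 * t ^ 2 * Real.log x) ≤ t * t ^ 3 := by gcongr
        _ = t ^ 4 := by ring
        _ ≤ t ^ 9 := pow_le_pow_right₀ (by linarith) (by norm_num)
        _ = x := hxt.symm)
    (by
      calc _ ≤ 3 * Real.log x * (2880 * t ^ 2) := by
            gcongr; exact natLog_two_floor_le h3 h4
        _ = _ := by ring)
  exact ⟨n, by exact_mod_cast hn1, by exact_mod_cast hn2, by push_cast; linarith,
    Int.squarefree_natCast.2 hn4⟩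
end
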